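/- arXiv:1910.12480 — 3 statements merged into one kernel-verified Lean document; each statement's English description precedes it below -/
import Mathlib

section
/- Every bipartite planar graph is 3-choosable: if G is planar and bipartite and L assigns a list of at least 3 colours to every vertex, then G has a proper L-colouring. -/
structure PlaneEmbedding {V : Type} (G : SimpleGraph V) where
  pos : V → ℝ × ℝ
  arc : V → V → Set.Icc (0:ℝ) 1 → ℝ × ℝ
  pos_inj : Function.Injective pos
  arc_cont : ∀ u v, G.Adj u v → Continuous (arc u v)
  arc_inj : ∀ u v, G.Adj u v → Function.Injective (arc u v)
  arc_start : ∀ u v, G.Adj u v → arc u v ⟨0, by norm_num⟩ = pos u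
  arc_end : ∀ u v, G.Adj u v → arc u v ⟨1, by norm_num⟩ = pos v
  arc_symm : ∀ u v, G.Adj u v → Set.range (arc u v) = Set.range (arc v u)
  arc_avoid : ∀ u v w, G.Adj u v → w ≠ u → w ≠ v → pos w ∉ Set.range (arc u v)
  arcs_meet_only_at_endpoints : ∀ u v x y, G.Adj u v → G.Adj x y →
    ({u, v} : Set V) ≠ {x, y} →
    Set.range (arc u v) ∩ Set.range (arc x y) ⊆ pos '' (({u, v} : Set V) ∩ {x, y})

/-- A graph is planar if it admits a drawing in the plane. -/
def SimpleGraph.IsPlanar {V : Type} (G : SimpleGraph V) : Prop := Nonempty (PlaneEmbedding G)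
/-- A proper colouring of `G` from the lists `L`. -/
def ProperListColoring {V : Type} (G : SimpleGraph V) (L : V → Finset ℕ) (φ : V → ℕ) : Prop :=
  (∀ v, φ v ∈ L v) ∧ ∀ u v, G.Adj u v → φ u ≠ φ v

theorem exists_kernel {V : Type*} (D : V → V → Prop) (side : V → Prop)
    (hD : ∀ u v, D u v → ¬(side u ↔ side v)) (S : Finset V) :
    ∃ K ⊆ S, (∀ u ∈ K, ∀ v ∈ K, ¬D u v) ∧ ∀ u ∈ S, u ∉ K → ∃ v ∈ K, D u v := by
  classical
  induction S using Finset.strongInduction with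
  | H S ih =>
    by_cases h : ∃ a ∈ S, ∀ b ∈ S, ¬D a b
    · obtain ⟨a, ha, hsink⟩ := h
      obtain ⟨K, hKS, hind, hdom⟩ := ih (S.filter fun v => v ≠ a ∧ ¬D v a) <| by
        refine Finset.filter_ssubset.2 ⟨a, ha, by simp⟩
      have hK : ∀ v ∈ K, v ∈ S ∧ v ≠ a ∧ ¬D v a := fun v hv => by simpa using hKS hv
      refine ⟨insert a K, ?_, ?_, ?_⟩
      · intro v hv
        rcases Finset.mem_insert.1 hv with rfl | hv
        exacts [ha, (hK v hv).1]
      · intro u hu v hv huv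
        rcases Finset.mem_insert.1 hu with hua | huK
        · refine hsink v ?_ (hua ▸ huv)
          rcases Finset.mem_insert.1 hv with rfl | hv
          exacts [ha, (hK v hv).1]
        · rcases Finset.mem_insert.1 hv with hva | hvK
          exacts [(hK u huK).2.2 (hva ▸ huv), hind u huK v hvK huv]
      · intro u hu huK
        rw [Finset.mem_insert, not_or] at huK
        by_cases hua : D u a
        · exact ⟨a, Finset.mem_insert_self _ _, hua⟩
        · obtain ⟨v, hv, huv⟩ := hdom u (by simp [hu, huK.1, hua]) huK.2
          exact ⟨v, Finset.mem_insert_of_mem hv, huv⟩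
    · push Not at h
      refine ⟨S.filter fun v => side v, Finset.filter_subset _ _, ?_, ?_⟩
      · intro u hu v hv huv
        have := hD u v huv
        simp_all
      · intro u hu huK
        obtain ⟨v, hv, huv⟩ := h u hu
        have := hD u v huv
        refine ⟨v, ?_, huv⟩
        simp_all

open Classical in
theorem exists_list_coloring_of_outdegree_lt {V : Type*} (D : V → V → Prop) (side : V → Prop)
    (hD : ∀ u v, D u v → ¬(side u ↔ side v)) (U : Finset V) (L : V → Finset ℕ)
    (hL : ∀ v ∈ U, (U.filter (D v)).card < (L v).card) :
    ∃ φ : V → ℕ, (∀ v ∈ U, φ v ∈ L v) ∧ ∀ u ∈ U, ∀ v ∈ U, D u v → φ u ≠ φ v := by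
  induction U using Finset.strongInduction generalizing L with
  | H U ih =>
    rcases U.eq_empty_or_nonempty with rfl | ⟨w, hw⟩
    · exact ⟨fun _ => 0, by simp, by simp⟩
    obtain ⟨c, hc⟩ := Finset.card_pos.1 (Nat.zero_lt_of_lt (hL w hw))
    obtain ⟨K, hKS, hind, hdom⟩ := exists_kernel D side hD (U.filter fun v => c ∈ L v)
    have hK : ∀ v ∈ K, v ∈ U ∧ c ∈ L v := fun v hv => by simpa using hKS hv
    have hne : K.Nonempty := by
      by_cases hwK : w ∈ K
      · exact ⟨w, hwK⟩
      · obtain ⟨v, hv, -⟩ := hdom w (by simp [hw, hc]) hwK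
        exact ⟨v, hv⟩
    obtain ⟨φ, hφ, hφD⟩ := ih (U \ K)
        (Finset.sdiff_ssubset (fun v hv => (hK v hv).1) hne) (fun v => (L v).erase c) <| by
      intro v hv
      rw [Finset.mem_sdiff] at hv
      have hsub : (U \ K).filter (D v) ⊆ U.filter (D v) :=
        Finset.filter_subset_filter _ Finset.sdiff_subset
      by_cases hcv : c ∈ L v
      · obtain ⟨x, hx, hvx⟩ := hdom v (by simp [hv.1, hcv]) hv.2
        have hlt : ((U \ K).filter (D v)).card < (U.filter (D v)).card := by
          refine Finset.card_lt_card (Finset.ssubset_iff_subset_ne.2 ⟨hsub, fun h => ?_⟩)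
          have : x ∈ (U \ K).filter (D v) := h ▸ by simp [(hK x hx).1, hvx]
          simp [hx] at this
        have := hL v hv.1
        rw [Finset.card_erase_of_mem hcv]
        omega
      · rw [Finset.erase_eq_of_notMem hcv]
        exact (Finset.card_le_card hsub).trans_lt (hL v hv.1)
    refine ⟨fun v => if v ∈ K then c else φ v, fun v hv => ?_, fun u hu v hv huv => ?_⟩
    · by_cases hvK : v ∈ K
      · simpa [hvK] using (hK v hvK).2
      · simpa [hvK] using Finset.mem_of_mem_erase (hφ v (by simp [hv, hvK]))
    · have key : ∀ x ∈ U, x ∉ K → φ x ≠ c := fun x hx hxK =>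
        Finset.ne_of_mem_erase (hφ x (by simp [hx, hxK]))
      by_cases huK : u ∈ K <;> by_cases hvK : v ∈ K
      · exact absurd huv (hind u huK v hvK)
      · simpa [huK, hvK] using (key v hv hvK).symm
      · simpa [huK, hvK] using key u hu huK
      · simpa [huK, hvK] using hφD u (by simp [hu, huK]) v (by simp [hv, hvK]) huv

/-- An edge of the square grid `ℤ × ℤ`: the point `g.1` joined to its right neighbour
(`g.2 = false`) or its upper neighbour (`g.2 = true`). -/
abbrev GridEdge : Type := (ℤ × ℤ) × Bool

namespace GridEdge

def src (g : GridEdge) : ℤ × ℤ := g.1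

def tgt : GridEdge → ℤ × ℤ
  | ((i, j), false) => (i + 1, j)
  | ((i, j), true) => (i, j + 1)

/-- The unit square above or to the right of an edge, named by its lower left corner. -/
def left (g : GridEdge) : ℤ × ℤ := g.1

/-- The unit square below or to the left of an edge, named by its lower left corner. -/
def right : GridEdge → ℤ × ℤ
  | ((i, j), false) => (i, j - 1)
  | ((i, j), true) => (i - 1, j)

/-- The mod 2 boundary of a chain of grid edges. -/
noncomputable def boundary : (GridEdge →₀ ZMod 2) →ₗ[ZMod 2] (ℤ × ℤ →₀ ZMod 2) :=
  Finsupp.linearCombination (ZMod 2)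
    fun g => Finsupp.single g.src 1 + Finsupp.single g.tgt 1

theorem boundary_apply (w : GridEdge →₀ ZMod 2) (i j : ℤ) :
    boundary w (i, j) =
      w ((i, j), false) + w ((i - 1, j), false) + w ((i, j), true) + w ((i, j - 1), true) := by
  induction w using Finsupp.induction_linear with
  | zero => simp
  | add f g hf hg => rw [map_add, Finsupp.add_apply, hf, hg]; simp only [Finsupp.add_apply]; ring
  | single g r =>
    obtain ⟨⟨a, b⟩, d⟩ := g
    have h1 : a = i - 1 ↔ a + 1 = i := by omega
    have h2 : b = j - 1 ↔ b + 1 = j := by omega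
    cases d <;>
      simp [boundary, src, tgt, Finsupp.single_apply, Prod.ext_iff, h1, h2]

theorem exists_int_antidifference (a : ℤ → ZMod 2) :
    ∃ f : ℤ → ZMod 2, f 0 = 0 ∧ ∀ i, f (i + 1) = f i + a (i + 1) := by
  refine ⟨fun i => ∑ k ∈ Finset.Ioc 0 i, a k + ∑ k ∈ Finset.Ioc i 0, a k, by simp, fun i => ?_⟩
  beta_reduce
  rcases le_or_gt 0 i with hi | hi
  · rw [Finset.Ioc_eq_empty_of_le (a := i) hi, Finset.Ioc_eq_empty_of_le (a := i + 1) (by omega),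
      show Finset.Ioc 0 (i + 1) = insert (i + 1) (Finset.Ioc 0 i) by ext; simp; omega,
      Finset.sum_insert (by simp)]
    simp [add_comm]
  · rw [Finset.Ioc_eq_empty_of_le (b := i) hi.le, Finset.Ioc_eq_empty_of_le (b := i + 1) (by omega),
      show Finset.Ioc i 0 = insert (i + 1) (Finset.Ioc (i + 1) 0) by ext; simp; omega,
      Finset.sum_insert (by simp)]
    have := CharTwo.add_self_eq_zero (a (i + 1))
    simp only [Finset.sum_empty, zero_add]
    linear_combination -this

/-- A closed mod 2 cochain on the grid is the coboundary of a function on the unit squares. -/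
theorem exists_potential (w : GridEdge → ZMod 2)
    (hw : ∀ i j,
      w ((i, j), false) + w ((i - 1, j), false) + w ((i, j), true) + w ((i, j - 1), true) = 0) :
    ∃ c : ℤ × ℤ → ZMod 2, ∀ g, w g = c g.left + c g.right := by
  obtain ⟨f, -, hf⟩ := exists_int_antidifference fun i => w ((i, 0), true)
  choose F hF0 hF using fun i => exists_int_antidifference fun j => w ((i, j), false)
  have two : (2 : ZMod 2) = 0 := rfl
  have hw' : ∀ i j, w ((i, j + 1), true) =
      w ((i, j), true) + w ((i, j + 1), false) + w ((i - 1, j + 1), false) := fun i j => by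
    have := hw i (j + 1)
    rw [add_sub_cancel_right] at this
    linear_combination this - (w ((i, j), true) + w ((i, j + 1), false) +
      w ((i - 1, j + 1), false)) * two
  have key : ∀ i j, w ((i, j), true) = (f i + F i j) + (f (i - 1) + F (i - 1) j) := by
    intro i j
    have h1 : ∀ k, F i (k + 1) + F (i - 1) (k + 1) = F i k + F (i - 1) k +
        (w ((i, k + 1), true) - w ((i, k), true)) := fun k => by
      rw [hF, hF, hw']; ring
    induction j using Int.induction_on with
    | zero =>
      have := hf (i - 1)
      rw [sub_add_cancel] at this
      rw [hF0, hF0, this]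
      linear_combination -f (i - 1) * two
    | succ k ih => linear_combination ih - h1 k
    | pred k ih =>
      have := h1 (-k - 1)
      rw [sub_add_cancel] at this
      linear_combination ih + this
  refine ⟨fun p => f p.1 + F p.1 p.2, ?_⟩
  rintro ⟨⟨i, j⟩, d⟩
  cases d
  · have := hF i (j - 1)
    rw [sub_add_cancel] at this
    simp only [left, right]
    linear_combination -this - (f i + F i (j - 1)) * two
  · simpa [left, right] using key i j

/-- Adjacency in the grid. -/
def Adj (x y : ℤ × ℤ) : Prop := ∃ g : GridEdge, g.src = x ∧ g.tgt = y ∨ g.src = y ∧ g.tgt = x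

/-- Any two points of `S` are joined by a grid path inside `S`. -/
def ConnectedOn (S : Set (ℤ × ℤ)) : Prop :=
  ∀ x ∈ S, ∀ y ∈ S, Relation.ReflTransGen (fun a b => Adj a b ∧ a ∈ S ∧ b ∈ S) x y

/-- The edges with both ends in `S`. -/
def inside (S : Set (ℤ × ℤ)) : Set GridEdge := {g | g.src ∈ S ∧ g.tgt ∈ S}

theorem single_one_add_self (x : ℤ × ℤ) :
    Finsupp.single x (1 : ZMod 2) + Finsupp.single x 1 = 0 := by
  rw [← Finsupp.single_add, CharTwo.add_self_eq_zero, Finsupp.single_zero]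

theorem ConnectedOn.single_add_single_mem {S : Set (ℤ × ℤ)} (hS : ConnectedOn S) {x y : ℤ × ℤ}
    (hx : x ∈ S) (hy : y ∈ S) :
    Finsupp.single x 1 + Finsupp.single y 1 ∈
      (Finsupp.supported (ZMod 2) (ZMod 2) (inside S)).map boundary := by
  induction hS x hx y hy with
  | refl => rw [single_one_add_self]; exact zero_mem _
  | tail _ h ih =>
    obtain ⟨⟨g, hg⟩, hb, hc⟩ := h
    have hmem : Finsupp.single g.src 1 + Finsupp.single g.tgt 1 ∈
        (Finsupp.supported (ZMod 2) (ZMod 2) (inside S)).map boundary := by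
      refine ⟨Finsupp.single g 1, Finsupp.single_mem_supported _ _ ?_, by simp [boundary]⟩
      rcases hg with ⟨rfl, rfl⟩ | ⟨rfl, rfl⟩
      exacts [⟨hb, hc⟩, ⟨hc, hb⟩]
    have h2 := add_mem (ih hb) hmem
    convert h2 using 1
    rcases hg with ⟨rfl, rfl⟩ | ⟨rfl, rfl⟩
    · rw [add_assoc, ← add_assoc (Finsupp.single g.src _) (Finsupp.single g.src _),
        single_one_add_self, zero_add]
    · rw [add_comm (Finsupp.single g.src _), add_assoc,
        ← add_assoc (Finsupp.single g.tgt _) (Finsupp.single g.tgt _),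
        single_one_add_self, zero_add]

theorem ConnectedOn.sum_single_mem {S : Set (ℤ × ℤ)} (hS : ConnectedOn S) {ι : Type*}
    (I : Finset ι) (p : ι → ℤ × ℤ) (a : ι → ZMod 2) (hp : ∀ e ∈ I, p e ∈ S)
    (ha : ∑ e ∈ I, a e = 0) :
    ∑ e ∈ I, Finsupp.single (p e) (a e) ∈
      (Finsupp.supported (ZMod 2) (ZMod 2) (inside S)).map boundary := by
  rcases I.eq_empty_or_nonempty with rfl | ⟨e₀, he₀⟩
  · simp
  have : ∑ e ∈ I, Finsupp.single (p e) (a e) =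
      ∑ e ∈ I, a e • (Finsupp.single (p e) 1 + Finsupp.single (p e₀) 1) := by
    simp only [smul_add, Finset.sum_add_distrib, ← Finset.sum_smul, ha, zero_smul, add_zero]
    simp only [Finsupp.smul_single, smul_eq_mul, mul_one]
  rw [this]
  exact sum_mem fun e he =>
    Submodule.smul_mem _ _ (hS.single_add_single_mem (hp e he) (hp e₀ he₀))

end GridEdge

open GridEdge

/-- A model, as a minor of the square grid, of the multigraph in which the edge `e : E` joins
`s e` to `t e`. -/
structure GridMinor {E V : Type*} (s t : E → V) where
  branch : V → Set (ℤ × ℤ)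
  finite_branch : ∀ v, (branch v).Finite
  connectedOn_branch : ∀ v, ConnectedOn (branch v)
  eq_of_mem : ∀ {x u v}, x ∈ branch u → x ∈ branch v → u = v
  edge : E → GridEdge
  edge_ends : ∀ e, (edge e).src ∈ branch (s e) ∧ (edge e).tgt ∈ branch (t e) ∨
    (edge e).src ∈ branch (t e) ∧ (edge e).tgt ∈ branch (s e)

open Classical in
/-- The mod 2 boundary map of the multigraph in which `e` joins `s e` to `t e`. -/
noncomputable def graphBoundary {E V : Type*} [Fintype E] (s t : E → V) :
    (E → ZMod 2) →ₗ[ZMod 2] (V → ZMod 2) where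
  toFun z v := ∑ e, z e * ((if s e = v then 1 else 0) + (if t e = v then 1 else 0))
  map_add' y z := by ext v; simp [add_mul, Finset.sum_add_distrib]
  map_smul' r z := by ext v; simp [Finset.mul_sum, mul_assoc]

namespace GridMinor

variable {E V : Type*} {s t : E → V} (M : GridMinor s t)

/-- The grid edges that survive in the minor or are contracted to a vertex. -/
def used : Set GridEdge := {g | (∃ v, g ∈ inside (M.branch v)) ∨ g ∈ Set.range M.edge}

theorem finite_used [Finite E] [Finite V] : M.used.Finite := by
  have : M.used = (⋃ v, inside (M.branch v)) ∪ Set.range M.edge := by ext; simp [used]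
  rw [this]
  refine (Set.finite_iUnion fun v => ?_).union (Set.finite_range _)
  refine ((M.finite_branch v).prod (Set.finite_univ (α := Bool))).subset fun g hg => ?_
  exact ⟨hg.1, trivial⟩

theorem edge_notMem_inside (hst : ∀ e, s e ≠ t e) (e : E) (v : V) :
    M.edge e ∉ inside (M.branch v) := fun h => by
  rcases M.edge_ends e with ⟨h1, h2⟩ | ⟨h1, h2⟩
  · exact hst e ((M.eq_of_mem h1 h.1).trans (M.eq_of_mem h2 h.2).symm)
  · exact hst e ((M.eq_of_mem h2 h.2).trans (M.eq_of_mem h1 h.1).symm)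

theorem edge_injective (hst : ∀ e e', s e ≠ t e')
    (hinj : ∀ e e', s e = s e' → t e = t e' → e = e') : Function.Injective M.edge := by
  intro e e' h
  have h' := M.edge_ends e'
  rw [← h] at h'
  rcases M.edge_ends e with ⟨h1, h2⟩ | ⟨h1, h2⟩ <;> rcases h' with ⟨h3, h4⟩ | ⟨h3, h4⟩
  · exact hinj _ _ (M.eq_of_mem h1 h3) (M.eq_of_mem h2 h4)
  · exact absurd (M.eq_of_mem h1 h3) (hst _ _)
  · exact absurd (M.eq_of_mem h3 h1) (hst _ _)
  · exact hinj _ _ (M.eq_of_mem h2 h4) (M.eq_of_mem h1 h3)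

/-- Two unit squares with a common side that is not used. -/
def SameFace (a b : ℤ × ℤ) : Prop := ∃ g ∉ M.used, g.left = a ∧ g.right = b

/-- The faces of the part of the grid that is used by the minor. -/
abbrev Face : Type := Quot M.SameFace

open Classical in
/-- The edges of the minor that border the face `q` on exactly one side. -/
noncomputable def faceBoundary (q : M.Face) (e : E) : ZMod 2 :=
  (if q = Quot.mk _ (M.edge e).left then 1 else 0) +
    (if q = Quot.mk _ (M.edge e).right then 1 else 0)

theorem sum_eq_zero_of_mem_ker [Fintype E] (hst : ∀ e e', s e ≠ t e') {z : E → ZMod 2}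
    (hz : z ∈ LinearMap.ker (graphBoundary s t)) [DecidableEq V] (v : V) :
    ∑ e with s e = v, z e = 0 ∧ ∑ e with t e = v, z e = 0 := by
  have h : ∑ e with s e = v, z e + ∑ e with t e = v, z e = 0 := by
    have := congrFun (LinearMap.mem_ker.1 hz) v
    simp only [graphBoundary, LinearMap.coe_mk, AddHom.coe_mk, Pi.zero_apply, mul_add, mul_ite,
      mul_one, mul_zero, Finset.sum_add_distrib] at this
    rw [Finset.sum_filter, Finset.sum_filter]
    convert this
  by_cases hv : ∃ e, s e = v
  · obtain ⟨e, rfl⟩ := hv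
    have : (Finset.univ.filter fun e' => t e' = s e) = ∅ :=
      Finset.filter_eq_empty_iff.2 fun e' _ h => hst e e' h.symm
    simp_all
  · have : (Finset.univ.filter fun e' => s e' = v) = ∅ :=
      Finset.filter_eq_empty_iff.2 fun e' _ h => hv ⟨e', h⟩
    simp_all

/-- A cycle of the minor lifts to a cycle of the grid. -/
theorem exists_lift [Fintype E] [Fintype V] (hst : ∀ e e', s e ≠ t e')
    (hinj : ∀ e e', s e = s e' → t e = t e' → e = e') {z : E → ZMod 2}
    (hz : z ∈ LinearMap.ker (graphBoundary s t)) :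
    ∃ w : GridEdge →₀ ZMod 2, boundary w = 0 ∧ (∀ g ∉ M.used, w g = 0) ∧
      ∀ e, w (M.edge e) = z e := by
  classical
  have hends : ∀ e, ∃ p q, p ∈ M.branch (s e) ∧ q ∈ M.branch (t e) ∧
      boundary (Finsupp.single (M.edge e) (z e)) =
        Finsupp.single p (z e) + Finsupp.single q (z e) := fun e => by
    have : boundary (Finsupp.single (M.edge e) (z e)) =
        Finsupp.single (M.edge e).src (z e) + Finsupp.single (M.edge e).tgt (z e) := by
      simp [boundary]
    rcases M.edge_ends e with ⟨h1, h2⟩ | ⟨h1, h2⟩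
    · exact ⟨_, _, h1, h2, this⟩
    · exact ⟨_, _, h2, h1, this.trans (add_comm _ _)⟩
  choose p q hp hq hpq using hends
  have hs : ∀ v, ∑ e with s e = v, Finsupp.single (p e) (z e) ∈ _ := fun v =>
    (M.connectedOn_branch v).sum_single_mem _ p z
      (fun e he => (Finset.mem_filter.1 he).2 ▸ hp e) (sum_eq_zero_of_mem_ker hst hz v).1
  have ht : ∀ v, ∑ e with t e = v, Finsupp.single (q e) (z e) ∈ _ := fun v =>
    (M.connectedOn_branch v).sum_single_mem _ q z
      (fun e he => (Finset.mem_filter.1 he).2 ▸ hq e) (sum_eq_zero_of_mem_ker hst hz v).2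
  choose a ha ha' using hs
  choose b hb hb' using ht
  have hzero : ∀ v g, g ∉ inside (M.branch v) → a v g = 0 ∧ b v g = 0 := fun v g hg =>
    ⟨(Finsupp.mem_supported' _ _).1 (ha v) g hg, (Finsupp.mem_supported' _ _).1 (hb v) g hg⟩
  refine ⟨∑ e, Finsupp.single (M.edge e) (z e) + ∑ v, (a v + b v), ?_, fun g hg => ?_,
    fun e => ?_⟩
  · simp only [map_add, map_sum, hpq, ha', hb', Finset.sum_add_distrib]
    rw [Finset.sum_fiberwise Finset.univ s fun e => Finsupp.single (p e) (z e),
      Finset.sum_fiberwise Finset.univ t fun e => Finsupp.single (q e) (z e)]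
    ext x
    exact CharTwo.add_self_eq_zero _
  · have h1 : ∀ e, M.edge e ≠ g := fun e h => hg (Or.inr ⟨e, h⟩)
    have h2 : ∀ v, g ∉ inside (M.branch v) := fun v h => hg (Or.inl ⟨v, h⟩)
    simp [h1, hzero _ _ (h2 _)]
  · have h2 := fun v => hzero v _ (M.edge_notMem_inside (fun e => hst e e) e v)
    simp [h2, Finsupp.single_apply,
      (M.edge_injective hst hinj).eq_iff]

theorem ker_le_span_faceBoundary [Fintype E] [Fintype V] (hst : ∀ e e', s e ≠ t e')
    (hinj : ∀ e e', s e = s e' → t e = t e' → e = e') (F : Finset M.Face)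
    (hF : ∀ e, Quot.mk _ (M.edge e).left ∈ F ∧ Quot.mk _ (M.edge e).right ∈ F) :
    LinearMap.ker (graphBoundary s t) ≤
      Submodule.span (ZMod 2) (M.faceBoundary '' {q ∈ F | M.faceBoundary q ≠ 0}) := by
  classical
  intro z hz
  obtain ⟨w, hw, hw0, hwz⟩ := M.exists_lift hst hinj hz
  obtain ⟨c, hc⟩ := exists_potential w fun i j => by rw [← boundary_apply, hw]; rfl
  let c' : M.Face → ZMod 2 := Quot.lift c <| by
    rintro a b ⟨g, hg, rfl, rfl⟩
    have := hc g
    rw [hw0 g hg] at this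
    exact (CharTwo.add_eq_zero.1 this.symm)
  have : z = ∑ q ∈ F, c' q • M.faceBoundary q := by
    ext e
    rw [← hwz e, hc, Finset.sum_apply]
    simp only [Pi.smul_apply, smul_eq_mul, faceBoundary, mul_add, mul_ite, mul_one, mul_zero,
      Finset.sum_add_distrib, Finset.sum_ite_eq', hF e, if_true]
    rfl
  rw [this]
  refine sum_mem fun q hq => Submodule.smul_mem _ _ ?_
  by_cases h : M.faceBoundary q = 0
  · rw [h]; exact zero_mem _
  · exact Submodule.subset_span ⟨q, ⟨hq, h⟩, rfl⟩

theorem faceBoundary_mem_ker [Fintype E] [Finite V] (hst : ∀ e e', s e ≠ t e')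
    (hinj : ∀ e e', s e = s e' → t e = t e' → e = e') (q : M.Face) :
    M.faceBoundary q ∈ LinearMap.ker (graphBoundary s t) := by
  classical
  let χ : ℤ × ℤ → ZMod 2 := fun a => if q = Quot.mk _ a then 1 else 0
  let H := M.finite_used.toFinset
  let w : GridEdge →₀ ZMod 2 := Finsupp.onFinset H (fun g => χ g.left + χ g.right) <| by
    intro g hg
    by_contra hgH
    refine hg ?_
    have : Quot.mk M.SameFace g.left = Quot.mk _ g.right :=
      Quot.sound ⟨g, by simpa [H] using hgH, rfl, rfl⟩
    simp only [χ, this]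
    exact CharTwo.add_self_eq_zero _
  have hw : boundary w = 0 := by
    ext ⟨i, j⟩
    rw [boundary_apply]
    simp only [w, Finsupp.onFinset_apply, left, right, Finsupp.coe_zero, Pi.zero_apply]
    have two : (2 : ZMod 2) = 0 := rfl
    linear_combination (χ (i, j) + χ (i - 1, j) + χ (i, j - 1) + χ (i - 1, j - 1)) * two
  rw [LinearMap.mem_ker]
  ext v
  let ι : ℤ × ℤ → ZMod 2 := fun x => if x ∈ M.branch v then 1 else 0
  have h1 : ∑ g ∈ H, w g * (ι g.src + ι g.tgt) = 0 := by
    have := congrArg (Finsupp.linearCombination (ZMod 2) ι) hw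
    rw [map_zero, boundary, Finsupp.linearCombination_apply _ w, map_finsuppSum,
      Finsupp.sum_of_support_subset w Finsupp.support_onFinset_subset _ (by simp)] at this
    simpa [mul_add] using this
  have h2 : ∑ g ∈ Finset.univ.image M.edge, w g * (ι g.src + ι g.tgt) =
      ∑ g ∈ H, w g * (ι g.src + ι g.tgt) := by
    refine Finset.sum_subset ?_ fun g hg hg' => ?_
    · intro g hg
      obtain ⟨e, -, rfl⟩ := Finset.mem_image.1 hg
      simp [H, used]
    · have : ∃ u, g ∈ inside (M.branch u) := by
        rcases M.finite_used.mem_toFinset.1 hg with h | ⟨e, rfl⟩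
        · exact h
        · simp at hg'
      obtain ⟨u, hu1, hu2⟩ := this
      have : ι g.src = ι g.tgt := by
        have : g.src ∈ M.branch v ↔ g.tgt ∈ M.branch v :=
          ⟨fun h => M.eq_of_mem hu1 h ▸ hu2, fun h => M.eq_of_mem hu2 h ▸ hu1⟩
        simp only [ι, this]
      rw [this, CharTwo.add_self_eq_zero, mul_zero]
  rw [h1, Finset.sum_image fun _ _ _ _ h => M.edge_injective hst hinj h] at h2
  rw [Pi.zero_apply, ← h2]
  refine Finset.sum_congr rfl fun e _ => ?_
  have hι : ∀ x u, x ∈ M.branch u → ι x = if u = v then 1 else 0 := fun x u hx => by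
    have : x ∈ M.branch v ↔ u = v := ⟨fun h => M.eq_of_mem hx h, fun h => h ▸ hx⟩
    simp only [ι, this]
  congr 1
  rcases M.edge_ends e with ⟨h3, h4⟩ | ⟨h3, h4⟩
  · rw [hι _ _ h3, hι _ _ h4]
  · rw [hι _ _ h3, hι _ _ h4, add_comm]

theorem four_le_card_support [Fintype E] (hst : ∀ e e', s e ≠ t e')
    (hinj : ∀ e e', s e = s e' → t e = t e' → e = e') {z : E → ZMod 2}
    (hz : z ∈ LinearMap.ker (graphBoundary s t)) (h0 : z ≠ 0) :
    4 ≤ (Finset.univ.filter fun e => z e ≠ 0).card := by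
  classical
  have hs : ∀ e, z e ≠ 0 → ∃ e', z e' ≠ 0 ∧ e' ≠ e ∧ s e' = s e := fun e he => by
    by_contra! h
    refine he ((Finset.sum_eq_single_of_mem e (by simp) ?_).symm.trans
      (sum_eq_zero_of_mem_ker hst hz (s e)).1)
    intro e' he' hne
    by_contra h'
    exact h e' h' hne (Finset.mem_filter.1 he').2
  have ht : ∀ e, z e ≠ 0 → ∃ e', z e' ≠ 0 ∧ e' ≠ e ∧ t e' = t e := fun e he => by
    by_contra! h
    refine he ((Finset.sum_eq_single_of_mem e (by simp) ?_).symm.trans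
      (sum_eq_zero_of_mem_ker hst hz (t e)).2)
    intro e' he' hne
    by_contra h'
    exact h e' h' hne (Finset.mem_filter.1 he').2
  obtain ⟨e₁, h1⟩ := Function.ne_iff.1 h0
  obtain ⟨e₂, h2, h21, hs21⟩ := hs e₁ h1
  obtain ⟨e₃, h3, h31, ht31⟩ := ht e₁ h1
  obtain ⟨e₄, h4, h42, ht42⟩ := ht e₂ h2
  have h32 : e₃ ≠ e₂ := fun h => h21 (hinj _ _ hs21 (h ▸ ht31))
  have h41 : e₄ ≠ e₁ := fun h => h21 (hinj _ _ hs21 (by rw [← ht42, h]))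
  have h43 : e₄ ≠ e₃ := fun h => h21 (hinj _ _ hs21 (by rw [← ht42, h, ht31]))
  have : ({e₁, e₂, e₃, e₄} : Finset E) ⊆ Finset.univ.filter fun e => z e ≠ 0 := by
    intro e he
    simp only [Finset.mem_insert, Finset.mem_singleton] at he
    rcases he with rfl | rfl | rfl | rfl <;> simpa
  refine le_trans ?_ (Finset.card_le_card this)
  simp [Finset.card_insert_of_notMem, h21.symm, h31.symm, h32.symm, h41.symm, h42.symm, h43.symm]

end GridMinor

/-- A bipartite graph that is a minor of the grid has at most twice as many edges as vertices. -/
theorem GridMinor.card_le {E V : Type*} [Fintype E] [Fintype V] {s t : E → V}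
    (M : GridMinor s t) (hst : ∀ e e', s e ≠ t e')
    (hinj : ∀ e e', s e = s e' → t e = t e' → e = e') :
    Fintype.card E ≤ 2 * Fintype.card V := by
  classical
  let F : Finset M.Face := Finset.univ.image (fun e => Quot.mk _ (M.edge e).left) ∪
    Finset.univ.image (fun e => Quot.mk _ (M.edge e).right)
  let F' := F.filter fun q => M.faceBoundary q ≠ 0
  have hker : Module.finrank (ZMod 2) (LinearMap.ker (graphBoundary s t)) ≤ F'.card := by
    refine (Submodule.finrank_mono (M.ker_le_span_faceBoundary hst hinj F ?_)).trans ?_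
    · simp [F]
    · have : M.faceBoundary '' {q ∈ F | M.faceBoundary q ≠ 0} =
          (F'.image M.faceBoundary : Finset (E → ZMod 2)) := by ext; simp [F']
      rw [this]
      exact (finrank_span_finset_le_card _).trans Finset.card_image_le
  have hrank := LinearMap.finrank_range_add_finrank_ker (graphBoundary s t)
  have hrange := Submodule.finrank_le (LinearMap.range (graphBoundary s t))
  rw [Module.finrank_fintype_fun_eq_card] at hrank hrange
  have hcount : F'.card * 4 ≤ (Finset.univ : Finset E).card * 2 := by
    refine Finset.card_mul_le_card_mul (fun q e => M.faceBoundary q e ≠ 0) ?_ ?_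
    · intro q hq
      exact four_le_card_support hst hinj (M.faceBoundary_mem_ker hst hinj q)
        (Finset.mem_filter.1 hq).2
    · intro e _
      refine (Finset.card_le_card (t := {Quot.mk _ (M.edge e).left, Quot.mk _ (M.edge e).right})
        fun q hq => ?_).trans Finset.card_le_two
      by_contra h
      simp only [Finset.mem_insert, Finset.mem_singleton, not_or] at h
      exact ((Finset.mem_bipartiteBelow _).1 hq).2 (by simp [faceBoundary, h])
  rw [Finset.card_univ] at hcount
  omega

open Filter

theorem GridEdge.Adj.symm {x y : ℤ × ℤ} (h : Adj x y) : Adj y x := by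
  obtain ⟨g, hg⟩ := h
  exact ⟨g, hg.symm⟩

/-- Joined by a grid path inside `S`. -/
def GridEdge.JoinedOn (S : Set (ℤ × ℤ)) : ℤ × ℤ → ℤ × ℤ → Prop :=
  Relation.ReflTransGen fun a b => Adj a b ∧ a ∈ S ∧ b ∈ S

theorem GridEdge.JoinedOn.symm {S : Set (ℤ × ℤ)} {x y : ℤ × ℤ} (h : JoinedOn S x y) :
    JoinedOn S y x :=
  have : Std.Symm fun a b => Adj a b ∧ a ∈ S ∧ b ∈ S := ⟨fun _ _ h => ⟨h.1.symm, h.2.2, h.2.1⟩⟩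
  Std.Symm.symm (r := Relation.ReflTransGen fun a b => Adj a b ∧ a ∈ S ∧ b ∈ S) _ _ h

theorem GridEdge.connectedOn_component (S : Set (ℤ × ℤ)) (x : ℤ × ℤ) :
    ConnectedOn {y | JoinedOn S x y} := by
  have key : ∀ y, JoinedOn S x y → JoinedOn {y | JoinedOn S x y} x y := by
    intro y hy
    induction hy with
    | refl => exact .refl
    | tail h1 h2 ih => exact ih.tail ⟨h2.1, h1, h1.tail h2⟩
  exact fun y hy z hz => (key y hy).symm.trans (key z hz)

theorem GridEdge.JoinedOn.mem {S : Set (ℤ × ℤ)} {x y : ℤ × ℤ} (h : JoinedOn S x y) (hx : x ∈ S) :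
    y ∈ S := by
  cases h with
  | refl => exact hx
  | tail _ h => exact h.2.2

theorem GridEdge.JoinedOn.exists_exit {S P : Set (ℤ × ℤ)} {x y : ℤ × ℤ} (h : JoinedOn S x y)
    (hx : x ∈ P) (hy : y ∉ P) : ∃ a ∈ P, ∃ b ∉ P, Adj a b ∧ b ∈ S := by
  induction h with
  | refl => exact absurd hx hy
  | @tail b c _ h ih =>
    by_cases hb : b ∈ P
    · exact ⟨b, hb, c, hy, h.1, h.2.2⟩
    · exact ih hb

theorem GridEdge.joinedOn_horizontal {S : Set (ℤ × ℤ)} {a c : ℤ} (b : ℤ) (hac : a ≤ c)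
    (h : ∀ m, a ≤ m → m ≤ c → (m, b) ∈ S) : JoinedOn S (a, b) (c, b) := by
  induction c, hac using Int.leInduction with
  | base => exact .refl
  | succ c hac ih =>
    refine (ih fun m h1 h2 => h m h1 (by omega)).tail
      ⟨⟨((c, b), false), .inl ⟨rfl, rfl⟩⟩, h _ (by omega) (by omega), h _ (by omega) le_rfl⟩

theorem GridEdge.joinedOn_vertical {S : Set (ℤ × ℤ)} {b d : ℤ} (a : ℤ) (hbd : b ≤ d)
    (h : ∀ m, b ≤ m → m ≤ d → (a, m) ∈ S) : JoinedOn S (a, b) (a, d) := by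
  induction d, hbd using Int.leInduction with
  | base => exact .refl
  | succ d hbd ih =>
    refine (ih fun m h1 h2 => h m h1 (by omega)).tail
      ⟨⟨((a, d), true), .inl ⟨rfl, rfl⟩⟩, h _ (by omega) (by omega), h _ (by omega) le_rfl⟩

/-- The grid points close to `K` after scaling the plane by `r`. -/
def gridNear (r : ℝ) (K : Set (ℝ × ℝ)) : Set (ℤ × ℤ) :=
  {x | ∃ k ∈ K, |(x.1 : ℝ) - r * k.1| ≤ 1 ∧ |(x.2 : ℝ) - r * k.2| ≤ 1}

theorem gridNear_mono {r : ℝ} {K K' : Set (ℝ × ℝ)} (h : K ⊆ K') : gridNear r K ⊆ gridNear r K' :=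
  fun _ ⟨k, hk, hx⟩ => ⟨k, h hk, hx⟩

noncomputable def gridRound (r : ℝ) (k : ℝ × ℝ) : ℤ × ℤ := (round (r * k.1), round (r * k.2))

theorem gridRound_mem {r : ℝ} {k k' : ℝ × ℝ} {K : Set (ℝ × ℝ)} (hk' : k' ∈ K)
    (h1 : |r * k.1 - r * k'.1| ≤ 1 / 2) (h2 : |r * k.2 - r * k'.2| ≤ 1 / 2) :
    gridRound r k ∈ gridNear r K := by
  refine ⟨k', hk', ?_, ?_⟩
  · have := abs_sub_round (r * k.1)
    simp only [gridRound, abs_le] at *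
    constructor <;> linarith
  · have := abs_sub_round (r * k.2)
    simp only [gridRound, abs_le] at *
    constructor <;> linarith

theorem gridRound_mem_self (r : ℝ) {k : ℝ × ℝ} {K : Set (ℝ × ℝ)} (hk : k ∈ K) :
    gridRound r k ∈ gridNear r K :=
  gridRound_mem hk (by simp) (by simp)

theorem connectedOn_gridNear_singleton (r : ℝ) (k : ℝ × ℝ) : ConnectedOn (gridNear r {k}) := by
  have mem : ∀ x : ℤ × ℤ, x ∈ gridNear r {k} ↔
      |(x.1 : ℝ) - r * k.1| ≤ 1 ∧ |(x.2 : ℝ) - r * k.2| ≤ 1 := fun x => by simp [gridNear]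
  have between : ∀ {a m c : ℤ} {ρ : ℝ}, |(a : ℝ) - ρ| ≤ 1 → |(c : ℝ) - ρ| ≤ 1 → a ≤ m → m ≤ c →
      |(m : ℝ) - ρ| ≤ 1 := fun {a m c ρ} ha hc h1 h2 => by
    have h1' : (a : ℝ) ≤ m := by exact_mod_cast h1
    have h2' : (m : ℝ) ≤ c := by exact_mod_cast h2
    rw [abs_le] at *
    constructor <;> linarith
  rintro ⟨a, b⟩ hx ⟨c, d⟩ hy
  have h1 : JoinedOn (gridNear r {k}) (a, b) (c, b) := by
    rw [mem] at hx hy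
    rcases le_total a c with h | h
    · exact joinedOn_horizontal b h fun m h1 h2 => (mem _).2 ⟨between hx.1 hy.1 h1 h2, hx.2⟩
    · exact (joinedOn_horizontal b h fun m h1 h2 =>
        (mem _).2 ⟨between hy.1 hx.1 h1 h2, hx.2⟩).symm
  have h2 : JoinedOn (gridNear r {k}) (c, b) (c, d) := by
    rw [mem] at hx hy
    rcases le_total b d with h | h
    · exact joinedOn_vertical c h fun m h1 h2 => (mem _).2 ⟨hy.1, between hx.2 hy.2 h1 h2⟩
    · exact (joinedOn_vertical c h fun m h1 h2 =>
        (mem _).2 ⟨hy.1, between hy.2 hx.2 h1 h2⟩).symm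
  exact h1.trans h2

theorem GridEdge.JoinedOn.mono {S T : Set (ℤ × ℤ)} (hST : S ⊆ T) {x y : ℤ × ℤ}
    (h : JoinedOn S x y) : JoinedOn T x y :=
  Relation.ReflTransGen.mono (p := fun a b => Adj a b ∧ a ∈ T ∧ b ∈ T)
    (fun _ _ h => ⟨h.1, hST h.2.1, hST h.2.2⟩) _ _ h

theorem connectedOn_gridNear (r : ℝ) {K : Set (ℝ × ℝ)} (hK : IsPreconnected K) :
    ConnectedOn (gridNear r K) := by
  let P : ℝ × ℝ → ℝ × ℝ → Prop := fun k k' =>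
    ∀ x ∈ gridNear r {k}, ∀ y ∈ gridNear r {k'}, JoinedOn (gridNear r K) x y
  have hblock : ∀ k ∈ K, ∀ x ∈ gridNear r {k}, ∀ y ∈ gridNear r {k},
      JoinedOn (gridNear r K) x y := fun k hk x hx y hy =>
    (show JoinedOn _ x y from connectedOn_gridNear_singleton r k x hx y hy).mono
      (gridNear_mono (Set.singleton_subset_iff.2 hk))
  have key : ∀ k ∈ K, ∀ k' ∈ K, P k k' := by
    intro k hk k' hk'
    refine hK.induction₂' P (fun k hk => ?_) ?_ hk hk'
    · have h1 : ∀ᶠ k' in nhds k, |r * k.1 - r * k'.1| < 1 / 2 :=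
        (show Continuous fun k' : ℝ × ℝ => |r * k.1 - r * k'.1| by fun_prop).continuousAt.eventually_lt
          continuousAt_const (by simp)
      have h2 : ∀ᶠ k' in nhds k, |r * k.2 - r * k'.2| < 1 / 2 :=
        (show Continuous fun k' : ℝ × ℝ => |r * k.2 - r * k'.2| by fun_prop).continuousAt.eventually_lt
          continuousAt_const (by simp)
      filter_upwards [nhdsWithin_le_nhds h1, nhdsWithin_le_nhds h2, self_mem_nhdsWithin]
        with k' h1 h2 hk'
      have hm : gridRound r k ∈ gridNear r {k} := gridRound_mem_self r rfl
      have hm' : gridRound r k ∈ gridNear r {k'} := gridRound_mem rfl h1.le h2.le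
      exact ⟨fun x hx y hy => (hblock k hk x hx _ hm).trans (hblock k' hk' _ hm' y hy),
        fun x hx y hy => (hblock k' hk' x hx _ hm').trans (hblock k hk _ hm y hy)⟩
    · intro a b c _ _ _ hab hbc x hx y hy
      have hm : gridRound r b ∈ gridNear r {b} := gridRound_mem_self r rfl
      exact (hab x hx _ hm).trans (hbc _ hm y hy)
  rintro x ⟨k, hk, hx⟩ y ⟨k', hk', hy⟩
  exact key k hk k' hk' x ⟨k, rfl, hx⟩ y ⟨k', rfl, hy⟩

theorem finite_gridNear (r : ℝ) {K : Set (ℝ × ℝ)} (hK : IsCompact K) :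
    (gridNear r K).Finite := by
  obtain ⟨C, hC⟩ := hK.isBounded.exists_norm_le
  obtain ⟨N, hN⟩ := exists_nat_gt (|r| * C + 1)
  refine (Set.finite_Icc ((-N, -N) : ℤ × ℤ) (N, N)).subset ?_
  rintro ⟨a, b⟩ ⟨k, hk, h1, h2⟩
  have hbound : ∀ {m : ℤ} {κ : ℝ}, |κ| ≤ C → |(m : ℝ) - r * κ| ≤ 1 → -(N : ℤ) ≤ m ∧ m ≤ N := by
    intro m κ hκ hm
    have h3 : |r * κ| ≤ |r| * C := by
      rw [abs_mul]
      exact mul_le_mul_of_nonneg_left hκ (abs_nonneg r)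
    rw [abs_le] at hm h3
    have h4 : -(N : ℝ) ≤ m := by linarith
    have h5 : (m : ℝ) ≤ N := by linarith
    exact ⟨by exact_mod_cast h4, by exact_mod_cast h5⟩
  have h3 := hbound ((norm_fst_le k).trans (hC k hk)) h1
  have h4 := hbound ((norm_snd_le k).trans (hC k hk)) h2
  exact ⟨⟨h3.1, h4.1⟩, ⟨h3.2, h4.2⟩⟩

theorem eventually_disjoint_gridNear {K K' : Set (ℝ × ℝ)} (hK : IsCompact K) (hK' : IsCompact K')
    (h : Disjoint K K') : ∀ᶠ r : ℝ in atTop, Disjoint (gridNear r K) (gridNear r K') := by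
  obtain ⟨δ, hδ, hdisj⟩ := h.exists_thickenings hK hK'.isClosed
  filter_upwards [eventually_gt_atTop (2 / δ), eventually_gt_atTop 0] with r hr hr0
  rw [Set.disjoint_left]
  rintro x ⟨k, hk, h1, h2⟩ ⟨k', hk', h3, h4⟩
  have hclose : ∀ {m a b : ℝ}, |m - r * a| ≤ 1 → |m - r * b| ≤ 1 → |a - b| < δ := by
    intro m a b ha hb
    have h5 : |r * (a - b)| ≤ 2 := by
      rw [abs_le] at *
      constructor <;> linarith
    rw [abs_mul, abs_of_pos hr0] at h5
    rw [div_lt_iff₀ hδ] at hr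
    exact lt_of_mul_lt_mul_left (h5.trans_lt hr) hr0.le
  have hdist : dist k k' < δ := by
    rw [Prod.dist_eq, Real.dist_eq, Real.dist_eq]
    exact max_lt (hclose h1 h3) (hclose h2 h4)
  exact Set.disjoint_left.1 hdisj (Metric.self_subset_thickening hδ _ hk)
    (Metric.mem_thickening_iff.2 ⟨k', hk', hdist⟩)

/-- The star at `v`: the point of `v` with its halves of the incident arcs. -/
def arcStar {E V : Type*} (s t : E → V) (pos : V → ℝ × ℝ) (A C : E → Set (ℝ × ℝ)) (v : V) :
    Set (ℝ × ℝ) :=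
  {pos v} ∪ (⋃ e : {e // s e = v}, A e) ∪ ⋃ e : {e // t e = v}, C e

theorem mem_arcStar {E V : Type*} {s t : E → V} {pos : V → ℝ × ℝ} {A C : E → Set (ℝ × ℝ)} {v : V}
    {x : ℝ × ℝ} : x ∈ arcStar s t pos A C v ↔
      x = pos v ∨ (∃ e, s e = v ∧ x ∈ A e) ∨ ∃ e, t e = v ∧ x ∈ C e := by
  simp [arcStar, or_assoc]

theorem isCompact_arcStar {E V : Type*} [Finite E] (s t : E → V) (pos : V → ℝ × ℝ)
    {A C : E → Set (ℝ × ℝ)} (hA : ∀ e, IsCompact (A e)) (hC : ∀ e, IsCompact (C e)) (v : V) :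
    IsCompact (arcStar s t pos A C v) := by
  have h1 : IsCompact (⋃ e : {e // s e = v}, A e) := isCompact_iUnion fun e => hA e
  have h2 : IsCompact (⋃ e : {e // t e = v}, C e) := isCompact_iUnion fun e => hC e
  exact (isCompact_singleton.union h1).union h2

theorem isPreconnected_arcStar {E V : Type*} (s t : E → V) (pos : V → ℝ × ℝ)
    {A C : E → Set (ℝ × ℝ)} (hA : ∀ e, IsPreconnected (A e)) (hC : ∀ e, IsPreconnected (C e))
    (hs : ∀ e, pos (s e) ∈ A e) (ht : ∀ e, pos (t e) ∈ C e) (v : V) :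
    IsPreconnected (arcStar s t pos A C v) := by
  refine isPreconnected_of_forall (pos v) fun x hx => ?_
  rcases mem_arcStar.1 hx with rfl | ⟨e, rfl, he⟩ | ⟨e, rfl, he⟩
  · exact ⟨{pos v}, by simpa using hx, rfl, rfl, isPreconnected_singleton⟩
  · exact ⟨A e, fun y hy => mem_arcStar.2 (.inr (.inl ⟨e, rfl, hy⟩)), hs e, he, hA e⟩
  · exact ⟨C e, fun y hy => mem_arcStar.2 (.inr (.inr ⟨e, rfl, hy⟩)), ht e, he, hC e⟩

/-- A drawing whose arcs are cut into a first part `A e` at `s e` and a last part `C e` at `t e`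
yields a model in the grid. -/
theorem nonempty_gridMinor {E V : Type*} [Finite E] [Finite V] {s t : E → V} (side : V → Prop)
    (hside : ∀ e, side (s e)) (hside' : ∀ e, ¬side (t e))
    {pos : V → ℝ × ℝ} (hpos : Function.Injective pos) {A C : E → Set (ℝ × ℝ)}
    (hAc : ∀ e, IsCompact (A e)) (hCc : ∀ e, IsCompact (C e))
    (hAp : ∀ e, IsPreconnected (A e)) (hCp : ∀ e, IsPreconnected (C e))
    (hs : ∀ e, pos (s e) ∈ A e) (ht : ∀ e, pos (t e) ∈ C e)
    (hAC : ∀ e, (A e ∩ C e).Nonempty)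
    (posA : ∀ w e, pos w ∈ A e → w = s e) (posC : ∀ w e, pos w ∈ C e → w = t e)
    (AA : ∀ e e' x, x ∈ A e → x ∈ A e' → s e = s e')
    (CC : ∀ e e' x, x ∈ C e → x ∈ C e' → t e = t e')
    (AC : ∀ e e' x, x ∈ A e → x ∈ C e' → e = e') :
    Nonempty (GridMinor s t) := by
  set K := arcStar s t pos A C
  have hKc : ∀ v, IsCompact (K v) := isCompact_arcStar s t pos hAc hCc
  have hKp : ∀ v, IsPreconnected (K v) := isPreconnected_arcStar s t pos hAp hCp hs ht
  have AK : ∀ e, A e ⊆ K (s e) := fun e x hx => mem_arcStar.2 (.inr (.inl ⟨e, rfl, hx⟩))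
  have CK : ∀ e, C e ⊆ K (t e) := fun e x hx => mem_arcStar.2 (.inr (.inr ⟨e, rfl, hx⟩))
  have posK : ∀ v, pos v ∈ K v := fun v => mem_arcStar.2 (.inl rfl)
  have hst : ∀ e e', s e ≠ t e' := fun e e' h => hside' e' (h ▸ hside e)
  have H1 : ∀ᶠ r : ℝ in atTop, ∀ u v, u ≠ v → (side u ↔ side v) →
      Disjoint (gridNear r (K u)) (gridNear r (K v)) := by
    simp only [eventually_all]
    refine fun u v huv hsv => eventually_disjoint_gridNear (hKc u) (hKc v)
      (Set.disjoint_left.2 fun x hu hv => huv ?_)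
    rcases mem_arcStar.1 hu with rfl | ⟨e, rfl, he⟩ | ⟨e, rfl, he⟩ <;>
      rcases mem_arcStar.1 hv with h | ⟨e', rfl, he'⟩ | ⟨e', rfl, he'⟩
    · exact hpos h
    · exact posA _ _ he'
    · exact posC _ _ he'
    · subst h; exact (posA _ _ he).symm
    · exact AA _ _ _ he he'
    · exact absurd (hsv.1 (hside e)) (hside' e')
    · subst h; exact (posC _ _ he).symm
    · exact absurd (hsv.2 (hside e')) (hside' e)
    · exact CC _ _ _ he he'
  have H2 : ∀ᶠ r : ℝ in atTop, ∀ u v, side u → ¬side v →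
      Disjoint (gridNear r {pos u}) (gridNear r (K v)) := by
    simp only [eventually_all]
    refine fun u v hu hv => eventually_disjoint_gridNear isCompact_singleton (hKc v)
      (Set.disjoint_singleton_left.2 fun h => hv ?_)
    rcases mem_arcStar.1 h with h | ⟨e, rfl, he⟩ | ⟨e, rfl, he⟩
    · exact hpos h ▸ hu
    · exact hside e
    · exact posC _ _ he ▸ hu
  have H3 : ∀ᶠ r : ℝ in atTop, ∀ e v, ¬side v → v ≠ t e →
      Disjoint (gridNear r (A e)) (gridNear r (K v)) := by
    simp only [eventually_all]
    refine fun e v hv hne => eventually_disjoint_gridNear (hAc e) (hKc v)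
      (Set.disjoint_left.2 fun x hx h => hne ?_)
    rcases mem_arcStar.1 h with rfl | ⟨e', rfl, he⟩ | ⟨e', rfl, he⟩
    · exact absurd (posA _ _ hx ▸ hside e) hv
    · exact absurd (hside e') hv
    · rw [AC _ _ _ hx he]
  obtain ⟨r, H1, H2, H3⟩ := (H1.and (H2.and H3)).exists
  let S : V → Set (ℤ × ℤ) := fun u => gridNear r (K u) \ ⋃ v : {v // ¬side v}, gridNear r (K v)
  have memS : ∀ u x, x ∈ S u ↔ x ∈ gridNear r (K u) ∧ ∀ v, ¬side v → x ∉ gridNear r (K v) :=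
    fun u x => by simp [S]
  have hbase : ∀ u, side u → gridRound r (pos u) ∈ S u := fun u hu =>
    (memS _ _).2 ⟨gridRound_mem_self r (posK u), fun v hv =>
      Set.disjoint_left.1 (H2 u v hu hv) (gridRound_mem_self r rfl)⟩
  let B : V → Set (ℤ × ℤ) := fun v =>
    {x | side v ∧ JoinedOn (S v) (gridRound r (pos v)) x ∨ ¬side v ∧ x ∈ gridNear r (K v)}
  have hBpos : ∀ v, side v → B v = {x | JoinedOn (S v) (gridRound r (pos v)) x} :=
    fun v hv => by simp [B, hv]
  have hBneg : ∀ v, ¬side v → B v = gridNear r (K v) := fun v hv => by simp [B, hv]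
  have hBS : ∀ v, side v → B v ⊆ S v := fun v hv x hx => by
    rw [hBpos v hv] at hx
    exact JoinedOn.mem hx (hbase v hv)
  have hBK : ∀ v, B v ⊆ gridNear r (K v) := fun v => by
    by_cases hv : side v
    · exact fun x hx => ((memS _ _).1 (hBS v hv hx)).1
    · exact (hBneg v hv).subset
  have hedge : ∀ e, ∃ g : GridEdge, g.src ∈ B (s e) ∧ g.tgt ∈ B (t e) ∨
      g.src ∈ B (t e) ∧ g.tgt ∈ B (s e) := by
    intro e
    obtain ⟨y, hyA, hyC⟩ := hAC e
    have hconn := connectedOn_gridNear r ((hAp e).union y hyA hyC (hCp e))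
    have hpath : JoinedOn _ _ _ := hconn _ (gridNear_mono Set.subset_union_left
      (gridRound_mem_self r (hs e))) _ (gridNear_mono Set.subset_union_right
      (gridRound_mem_self r (ht e)))
    obtain ⟨a, ha, b, hb, hab, hbS⟩ := hpath.exists_exit (P := B (s e))
      (by rw [hBpos _ (hside e)]; exact .refl)
      (fun h => ((memS _ _).1 (hBS _ (hside e) h)).2 _ (hside' e)
        (gridNear_mono (CK e) (gridRound_mem_self r (ht e))))
    have hbt : b ∈ B (t e) := by
      rw [hBneg _ (hside' e)]
      obtain ⟨k, hk | hk, hbk⟩ := hbS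
      · by_contra hbt
        refine hb ?_
        rw [hBpos _ (hside e)]
        have ha' := hBS _ (hside e) ha
        rw [hBpos _ (hside e)] at ha
        refine ha.tail ⟨hab, ha', (memS _ _).2 ⟨⟨k, AK e hk, hbk⟩, fun v hv hbv => ?_⟩⟩
        by_cases hvt : v = t e
        · exact hbt (hvt ▸ hbv)
        · exact Set.disjoint_left.1 (H3 e v hv hvt) ⟨k, hk, hbk⟩ hbv
      · exact ⟨k, CK e hk, hbk⟩
    obtain ⟨g, ⟨rfl, rfl⟩ | ⟨rfl, rfl⟩⟩ := hab
    exacts [⟨g, .inl ⟨ha, hbt⟩⟩, ⟨g, .inr ⟨hbt, ha⟩⟩]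
  choose edge hedge using hedge
  refine ⟨⟨B, fun v => (finite_gridNear r (hKc v)).subset (hBK v), fun v => ?_, ?_, edge, hedge⟩⟩
  · by_cases hv : side v
    · rw [hBpos v hv]
      exact connectedOn_component _ _
    · rw [hBneg v hv]
      exact connectedOn_gridNear r (hKp v)
  · intro x u v hu hv
    by_contra huv
    by_cases hsu : side u <;> by_cases hsv : side v
    · exact Set.disjoint_left.1 (H1 u v huv (by simp [hsu, hsv])) (hBK u hu) (hBK v hv)
    · exact ((memS _ _).1 (hBS u hsu hu)).2 v hsv (hBK v hv)
    · exact ((memS _ _).1 (hBS v hsv hv)).2 u hsu (hBK u hu)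
    · exact Set.disjoint_left.1 (H1 u v huv (by simp [hsu, hsv])) (hBK u hu) (hBK v hv)

/-- The restriction of a grid model to a set of edges and a set of vertices. -/
def GridMinor.restrict {E V : Type*} {s t : E → V} (M : GridMinor s t) (S : Finset E)
    (W : Finset V) (hs : ∀ e ∈ S, s e ∈ W) (ht : ∀ e ∈ S, t e ∈ W) :
    GridMinor (E := S) (V := W) (fun e => ⟨s e, hs e e.2⟩) fun e => ⟨t e, ht e e.2⟩ where
  branch v := M.branch v
  finite_branch v := M.finite_branch v
  connectedOn_branch v := M.connectedOn_branch v
  eq_of_mem hu hv := Subtype.ext (M.eq_of_mem hu hv)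
  edge e := M.edge e
  edge_ends e := M.edge_ends e

/-- The edges can be assigned to their ends so that every vertex receives at most two. -/
theorem GridMinor.exists_orientation {E V : Type*} [Fintype V] {s t : E → V}
    (M : GridMinor s t) (hst : ∀ e e', s e ≠ t e')
    (hinj : ∀ e e', s e = s e' → t e = t e' → e = e') :
    ∃ f : E → V × Fin 2, Function.Injective f ∧ ∀ e, (f e).1 = s e ∨ (f e).1 = t e := by
  classical
  obtain ⟨f, hf, hmem⟩ := (Finset.all_card_le_biUnion_card_iff_exists_injective
    fun e => ({s e, t e} : Finset V) ×ˢ (Finset.univ : Finset (Fin 2))).1 fun S => by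
      have h := (M.restrict S (S.image s ∪ S.image t)
        (fun e he => Finset.mem_union_left _ (Finset.mem_image_of_mem _ he))
        (fun e he => Finset.mem_union_right _ (Finset.mem_image_of_mem _ he))).card_le
        (fun e e' h => hst e e' (congrArg Subtype.val h))
        (fun e e' h h' => Subtype.ext (hinj e e' (congrArg Subtype.val h) (congrArg Subtype.val h')))
      rw [Fintype.card_coe, Fintype.card_coe] at h
      have hcard : 2 * (S.image s ∪ S.image t).card =
          ((S.image s ∪ S.image t) ×ˢ (Finset.univ : Finset (Fin 2))).card := by
        rw [Finset.card_product, Finset.card_univ, Fintype.card_fin, mul_comm]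
      refine (h.trans hcard.le).trans (Finset.card_le_card fun x hx => ?_)
      simp only [Finset.mem_product, Finset.mem_union, Finset.mem_image, Finset.mem_univ,
        and_true] at hx
      simp only [Finset.mem_biUnion, Finset.mem_product, Finset.mem_insert, Finset.mem_singleton,
        Finset.mem_univ, and_true]
      rcases hx with ⟨e, he, h⟩ | ⟨e, he, h⟩
      exacts [⟨e, he, .inl h.symm⟩, ⟨e, he, .inr h.symm⟩]
  exact ⟨f, hf, fun e => by simpa using hmem e⟩

theorem GridMinor.exists_list_coloring {E V : Type*} [Fintype V] {s t : E → V}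
    (M : GridMinor s t) (side : V → Prop) (hside : ∀ e, side (s e)) (hside' : ∀ e, ¬side (t e))
    (hinj : ∀ e e', s e = s e' → t e = t e' → e = e') (L : V → Finset ℕ)
    (hL : ∀ v, 3 ≤ (L v).card) :
    ∃ φ : V → ℕ, (∀ v, φ v ∈ L v) ∧ ∀ e, φ (s e) ≠ φ (t e) := by
  classical
  have hst : ∀ e e', s e ≠ t e' := fun e e' h => hside' e' (h ▸ hside e)
  obtain ⟨f, hf, hfe⟩ := M.exists_orientation hst hinj
  let D : V → V → Prop := fun u v =>
    ∃ e, (f e).1 = u ∧ (s e = u ∧ t e = v ∨ t e = u ∧ s e = v)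
  have hout : ∀ u, (Finset.univ.filter (D u)).card ≤ 2 := by
    intro u
    have hchoose : ∀ v, ∃ i : Fin 2, D u v →
        ∃ e, f e = (u, i) ∧ (s e = u ∧ t e = v ∨ t e = u ∧ s e = v) := fun v => by
      by_cases h : D u v
      · obtain ⟨e, he, h⟩ := h
        exact ⟨(f e).2, fun _ => ⟨e, Prod.ext he rfl, h⟩⟩
      · exact ⟨0, fun h' => absurd h' h⟩
    choose i hi using hchoose
    refine (Finset.card_le_card_of_injOn i (t := Finset.univ) (by simp) ?_).trans (by simp)
    intro v hv w hw hvw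
    obtain ⟨e, he, h⟩ := hi v (by simpa using hv)
    obtain ⟨e', he', h'⟩ := hi w (by simpa using hw)
    obtain rfl : e = e' := hf (by rw [he, he', hvw])
    rcases h with ⟨h1, h2⟩ | ⟨h1, h2⟩ <;> rcases h' with ⟨h3, h4⟩ | ⟨h3, h4⟩
    · exact h2.symm.trans h4
    · exact absurd (h1.trans h3.symm) (hst e e)
    · exact absurd (h3.trans h1.symm) (hst e e)
    · exact h2.symm.trans h4
  obtain ⟨φ, hφ, hφD⟩ := exists_list_coloring_of_outdegree_lt D side
    (by
      rintro u v ⟨e, -, ⟨rfl, rfl⟩ | ⟨rfl, rfl⟩⟩ <;> simp [hside, hside'])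
    Finset.univ L (fun v _ => by
      have := hout v
      have := hL v
      convert (show (Finset.univ.filter (D v)).card < (L v).card by omega))
  refine ⟨φ, fun v => hφ v (Finset.mem_univ v), fun e => ?_⟩
  rcases hfe e with h | h
  · exact hφD _ (Finset.mem_univ _) _ (Finset.mem_univ _) ⟨e, h, .inl ⟨rfl, rfl⟩⟩
  · exact (hφD _ (Finset.mem_univ _) _ (Finset.mem_univ _) ⟨e, h, .inr ⟨rfl, rfl⟩⟩).symm

/-- The edges of a graph from a set of vertices to its complement. -/
abbrev CrossEdge {V : Type*} (G : SimpleGraph V) (side : V → Prop) : Type _ :=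
  {p : V × V // G.Adj p.1 p.2 ∧ side p.1 ∧ ¬side p.2}

namespace PlaneEmbedding

variable {V : Type} {G : SimpleGraph V} (P : PlaneEmbedding G)

/-- The piece of the arc from `u` to `v` with parameters in `[a, b]`. -/
def piece (a b : ℝ) (u v : V) : Set (ℝ × ℝ) :=
  P.arc u v '' {τ | a ≤ τ ∧ τ ≤ b}

variable {P} in
theorem piece_subset_range {a b : ℝ} {u v : V} : P.piece a b u v ⊆ Set.range (P.arc u v) :=
  Set.image_subset_range _ _

theorem isCompact_piece {a b : ℝ} {u v : V} (h : G.Adj u v) : IsCompact (P.piece a b u v) := by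
  refine IsCompact.image (IsClosed.isCompact ?_) (P.arc_cont u v h)
  exact (isClosed_le continuous_const continuous_subtype_val).inter
    (isClosed_le continuous_subtype_val continuous_const)

theorem isPreconnected_piece {a b : ℝ} (ha : 0 ≤ a) (hb : b ≤ 1) {u v : V} (h : G.Adj u v) :
    IsPreconnected (P.piece a b u v) := by
  have : {τ : Set.Icc (0 : ℝ) 1 | a ≤ τ ∧ τ ≤ b} =
      Set.projIcc 0 1 zero_le_one '' Set.Icc a b := by
    ext τ
    constructor
    · exact fun hτ => ⟨τ, hτ, Set.projIcc_val _ τ⟩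
    · rintro ⟨x, hx, rfl⟩
      rw [Set.mem_ofPred_eq, Set.projIcc_of_mem zero_le_one ⟨ha.trans hx.1, hx.2.trans hb⟩]
      exact hx
  rw [piece, this]
  exact (isPreconnected_Icc.image _ continuous_projIcc.continuousOn).image _
    (P.arc_cont u v h).continuousOn

theorem pos_mem_arc {u v w : V} (h : G.Adj u v) (hw : P.pos w ∈ Set.range (P.arc u v)) :
    w = u ∨ w = v := by
  by_contra! hne
  exact P.arc_avoid u v w h hne.1 hne.2 hw

theorem eq_of_pos_mem_initial_piece {b : ℝ} (hb : b < 1) {u v w : V} (h : G.Adj u v)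
    (hw : P.pos w ∈ P.piece 0 b u v) : w = u := by
  refine (P.pos_mem_arc h (piece_subset_range hw)).resolve_right ?_
  rintro rfl
  obtain ⟨τ, hτ, hτw⟩ := hw
  rw [← P.arc_end u w h] at hτw
  rw [P.arc_inj u w h hτw] at hτ
  exact absurd hτ.2 (not_le.2 hb)

theorem eq_of_pos_mem_final_piece {a : ℝ} (ha : 0 < a) {u v w : V} (h : G.Adj u v)
    (hw : P.pos w ∈ P.piece a 1 u v) : w = v := by
  refine (P.pos_mem_arc h (piece_subset_range hw)).resolve_left ?_
  rintro rfl
  obtain ⟨τ, hτ, hτw⟩ := hw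
  rw [← P.arc_start w v h] at hτw
  rw [P.arc_inj w v h hτw] at hτ
  exact absurd hτ.1 (not_le.2 ha)

variable {side : V → Prop}

theorem eq_or_exists_of_mem_arc {e e' : CrossEdge G side} {x : ℝ × ℝ}
    (hx : x ∈ Set.range (P.arc e.1.1 e.1.2)) (hx' : x ∈ Set.range (P.arc e'.1.1 e'.1.2)) :
    e = e' ∨ ∃ w, x = P.pos w := by
  by_cases h : ({e.1.1, e.1.2} : Set V) = {e'.1.1, e'.1.2}
  · left
    have h1 : e.1.1 ∈ ({e'.1.1, e'.1.2} : Set V) := h ▸ Set.mem_insert _ _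
    have h2 : e.1.2 ∈ ({e'.1.1, e'.1.2} : Set V) := h ▸ Set.mem_insert_of_mem _ rfl
    refine Subtype.ext (Prod.ext (h1.resolve_right fun h => ?_) (h2.resolve_left fun h => ?_))
    · exact e'.2.2.2 ((show e.1.1 = e'.1.2 from h) ▸ e.2.2.1)
    · exact e.2.2.2 ((show e.1.2 = e'.1.1 from h) ▸ e'.2.2.1)
  · right
    obtain ⟨w, -, hw⟩ := P.arcs_meet_only_at_endpoints _ _ _ _ e.2.1 e'.2.1 h ⟨hx, hx'⟩
    exact ⟨w, hw.symm⟩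

theorem nonempty_gridMinor {V : Type} {G : SimpleGraph V} (P : PlaneEmbedding G) [Finite V]
    (side : V → Prop) :
    Nonempty (GridMinor (fun e : CrossEdge G side => e.1.1) fun e => e.1.2) := by
  have posA : ∀ w (e : CrossEdge G side), P.pos w ∈ P.piece 0 (1 / 2) e.1.1 e.1.2 → w = e.1.1 :=
    fun w e => P.eq_of_pos_mem_initial_piece (by norm_num) e.2.1
  have posC : ∀ w (e : CrossEdge G side), P.pos w ∈ P.piece (1 / 2) 1 e.1.1 e.1.2 → w = e.1.2 :=
    fun w e => P.eq_of_pos_mem_final_piece (by norm_num) e.2.1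
  refine _root_.nonempty_gridMinor side (fun e => e.2.2.1) (fun e => e.2.2.2) P.pos_inj
    (A := fun e => P.piece 0 (1 / 2) e.1.1 e.1.2) (C := fun e => P.piece (1 / 2) 1 e.1.1 e.1.2)
    (fun e => P.isCompact_piece e.2.1) (fun e => P.isCompact_piece e.2.1)
    (fun e => P.isPreconnected_piece le_rfl (by norm_num) e.2.1)
    (fun e => P.isPreconnected_piece (by norm_num) le_rfl e.2.1)
    (fun e => ⟨⟨0, by norm_num⟩, by norm_num, P.arc_start _ _ e.2.1⟩)
    (fun e => ⟨⟨1, by norm_num⟩, by norm_num, P.arc_end _ _ e.2.1⟩)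
    (fun e => ⟨P.arc _ _ ⟨1 / 2, by norm_num⟩, ⟨_, by norm_num, rfl⟩, ⟨_, by norm_num, rfl⟩⟩)
    posA posC ?_ ?_ ?_
  · intro e e' x hx hx'
    rcases P.eq_or_exists_of_mem_arc (piece_subset_range hx) (piece_subset_range hx') with
      rfl | ⟨w, rfl⟩
    exacts [rfl, (posA _ _ hx).symm.trans (posA _ _ hx')]
  · intro e e' x hx hx'
    rcases P.eq_or_exists_of_mem_arc (piece_subset_range hx) (piece_subset_range hx') with
      rfl | ⟨w, rfl⟩
    exacts [rfl, (posC _ _ hx).symm.trans (posC _ _ hx')]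
  · intro e e' x hx hx'
    rcases P.eq_or_exists_of_mem_arc (piece_subset_range hx) (piece_subset_range hx') with
      rfl | ⟨w, rfl⟩
    exacts [rfl, absurd (posA _ _ hx ▸ e.2.2.1) (posC _ _ hx' ▸ e'.2.2.2)]

end PlaneEmbedding

/-- every bipartite planar graph is 3-choosable. -/
theorem bipartite_planar_3_choosable {V : Type} [Fintype V]
    (G : SimpleGraph V) (hplanar : G.IsPlanar) (hbip : G.Colorable 2)
    (L : V → Finset ℕ) (hL : ∀ v, 3 ≤ (L v).card) :
    ∃ φ : V → ℕ, ProperListColoring G L φ := by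
  obtain ⟨P⟩ := hplanar
  obtain ⟨col⟩ := hbip
  obtain ⟨M⟩ := P.nonempty_gridMinor fun v => col v = 0
  obtain ⟨φ, hφ, hproper⟩ := M.exists_list_coloring (fun v => col v = 0) (fun e => e.2.2.1) (fun e => e.2.2.2)
    (fun e e' h h' => Subtype.ext (Prod.ext h h')) L hL
  refine ⟨φ, hφ, fun u v huv => ?_⟩
  have hne := col.valid huv
  by_cases hu : col u = 0
  · exact hproper ⟨(u, v), huv, hu, fun hv => hne (hu.trans hv.symm)⟩
  · have hv : col v = 0 := by
      by_contra hv
      exact hne (by omega)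
    exact (hproper ⟨(v, u), huv.symm, hv, hu⟩).symm
end

section
/- Let G be a plane graph whose outer boundary is a cycle, and suppose G has no separating 4-cycle (a 4-cycle with at least one vertex strictly inside and at least one vertex strictly outside). If a vertex w lies in the interior of a 4-cycle C = x₁x₂x₃x₄ of G and w is adjacent to x₁ and x₃, then the interior of the 4-cycle x₁x₂x₃w contains no vertex of G, i.e., x₁x₂x₃w bounds a face. -/
/-- The set of points of the plane used by the drawing. -/
def PlaneEmbedding.drawing {V : Type} {G : SimpleGraph V} (E : PlaneEmbedding G) :
    Set (ℝ × ℝ) :=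
  Set.range E.pos ∪ ⋃ (u) (v) (_ : G.Adj u v), Set.range (E.arc u v)

/-- The outer (infinite) face: the union of the unbounded connected components of the
complement of the drawing. -/
def PlaneEmbedding.outerFace {V : Type} {G : SimpleGraph V} (E : PlaneEmbedding G) :
    Set (ℝ × ℝ) :=
  {p | p ∉ E.drawing ∧ ¬ Bornology.IsBounded (connectedComponentIn E.drawingᶜ p)}

/-- A vertex lies on the boundary of the outer face. -/
def PlaneEmbedding.OnOuterBoundary {V : Type} {G : SimpleGraph V} (E : PlaneEmbedding G)
    (v : V) : Prop :=
  E.pos v ∈ frontier E.outerFace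

/-- The drawing of a 4-cycle `a b c d`. -/
def PlaneEmbedding.quadDrawing {V : Type} {G : SimpleGraph V} (E : PlaneEmbedding G)
    (a b c d : V) : Set (ℝ × ℝ) :=
  Set.range (E.arc a b) ∪ Set.range (E.arc b c) ∪ Set.range (E.arc c d) ∪
    Set.range (E.arc d a)

/-- The open interior region of the 4-cycle `a b c d`: the union of the bounded components
of the complement of its drawing. -/
def PlaneEmbedding.insideQuad {V : Type} {G : SimpleGraph V} (E : PlaneEmbedding G)
    (a b c d : V) : Set (ℝ × ℝ) :=
  {p | p ∉ E.quadDrawing a b c d ∧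
    Bornology.IsBounded (connectedComponentIn (E.quadDrawing a b c d)ᶜ p)}

/-- The open exterior region of the 4-cycle `a b c d`. -/
def PlaneEmbedding.outsideQuad {V : Type} {G : SimpleGraph V} (E : PlaneEmbedding G)
    (a b c d : V) : Set (ℝ × ℝ) :=
  {p | p ∉ E.quadDrawing a b c d ∧
    ¬ Bornology.IsBounded (connectedComponentIn (E.quadDrawing a b c d)ᶜ p)}

/-- `a b c d` are the vertices, in order, of a 4-cycle of `G`. -/
def SimpleGraph.IsQuad {V : Type} (G : SimpleGraph V) (a b c d : V) : Prop :=
  G.Adj a b ∧ G.Adj b c ∧ G.Adj c d ∧ G.Adj d a ∧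
    a ≠ b ∧ a ≠ c ∧ a ≠ d ∧ b ≠ c ∧ b ≠ d ∧ c ≠ d

/-- A nowhere vanishing continuous function on the complex plane has a continuous logarithm. -/
theorem exists_continuous_log {f : ℂ → ℂ} (hf : Continuous f) (h0 : ∀ z, f z ≠ 0) :
    ∃ L : ℂ → ℂ, Continuous L ∧ ∀ z, Complex.exp (L z) = f z := by
  obtain ⟨F, ⟨-, hF⟩, -⟩ := Complex.isCoveringMapOn_exp.existsUnique_continuousMap_lifts
    (⟨f, hf⟩ : C(ℂ, ℂ)) (a₀ := 0) (e₀ := Complex.log (f 0)) (Complex.exp_log (h0 0)) h0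
  exact ⟨F, F.continuous, fun z => congrFun hF z⟩

/-- The identity of a circle around the origin has no continuous logarithm. -/
theorem not_continuous_log_on_circle {L : ℂ → ℂ} (hL : Continuous L) {c : ℂ} {R : ℝ}
    (h : ∀ t : ℝ, Complex.exp (L (c + R * Complex.exp (t * Complex.I))) =
      R * Complex.exp (t * Complex.I)) (hR : 0 < R) : False := by
  have hR0 : (R : ℂ) ≠ 0 := by exact_mod_cast hR.ne'
  set l : ℝ → ℂ := fun t =>
    (L (c + R * Complex.exp (t * Complex.I)) - Complex.log R - t * Complex.I) /
      (2 * Real.pi * Complex.I) with hl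
  have hlc : Continuous l := by fun_prop
  have hint : ∀ t, ∃ n : ℤ, l t = n := by
    intro t
    have : Complex.exp (L (c + R * Complex.exp (t * Complex.I))) =
        Complex.exp (Complex.log R + t * Complex.I) := by
      rw [h, Complex.exp_add, Complex.exp_log hR0]
    obtain ⟨n, hn⟩ := Complex.exp_eq_exp_iff_exists_int.1 this
    refine ⟨n, ?_⟩
    simp only [hl]
    rw [hn, div_eq_iff Complex.two_pi_I_ne_zero]
    ring
  choose n hn using hint
  have hnc : Continuous n := by
    refine Int.isClosedEmbedding_coe_real.continuous_iff.2 ?_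
    have : ((↑) : ℤ → ℝ) ∘ n = fun t => (l t).re := by
      ext t
      simp [hn]
    rw [this]
    fun_prop
  have hconst : n 0 = n (2 * Real.pi) := PreconnectedSpace.constant inferInstance hnc
  have h01 : l 0 = l (2 * Real.pi) := by rw [hn, hn, hconst]
  simp only [hl] at h01
  rw [div_left_inj' Complex.two_pi_I_ne_zero] at h01
  push_cast at h01
  rw [Complex.exp_two_pi_mul_I] at h01
  have hzero : (2 * Real.pi * Complex.I : ℂ) = 0 := by
    simp only [zero_mul, Complex.exp_zero, sub_zero] at h01
    linear_combination h01
  exact Complex.two_pi_I_ne_zero hzero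

/-- A continuous self-map of the plane which fixes the frontier of a bounded set `V` covers `V`. -/
theorem Complex.subset_range_of_eqOn_frontier {V : Set ℂ} (hV : Bornology.IsBounded V) {r : ℂ → ℂ}
    (hr : Continuous r) (hfix : ∀ z ∈ frontier V, r z = z) : V ⊆ Set.range r := by
  classical
  intro c hc
  by_contra hcr
  have hg : Continuous (V.piecewise r id) := hr.piecewise hfix continuous_id
  have hne : ∀ z, V.piecewise r id z - c ≠ 0 := by
    intro z
    rw [sub_ne_zero]
    by_cases hz : z ∈ V
    · rw [Set.piecewise_eq_of_mem _ _ _ hz]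
      rintro rfl
      exact hcr ⟨z, rfl⟩
    · rw [Set.piecewise_eq_of_notMem _ _ _ hz]
      rintro rfl
      exact hz hc
  obtain ⟨L, hL, hexp⟩ := exists_continuous_log (hg.sub continuous_const) hne
  obtain ⟨R, hR, hVR⟩ := hV.subset_ball_lt 0 c
  refine not_continuous_log_on_circle hL (c := c) (R := R) (fun t => ?_) hR
  have hout : c + R * Complex.exp (t * Complex.I) ∉ V := by
    intro hmem
    have := hVR hmem
    simp [Complex.norm_exp_ofReal_mul_I, abs_of_pos hR] at this
  rw [hexp, Pi.sub_apply, Set.piecewise_eq_of_notMem _ _ _ hout]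
  simp

theorem subset_range_of_eqOn_frontier {V : Set (ℝ × ℝ)} (hV : Bornology.IsBounded V)
    {r : ℝ × ℝ → ℝ × ℝ} (hr : Continuous r) (hfix : ∀ z ∈ frontier V, r z = z) :
    V ⊆ Set.range r := by
  set e := Complex.equivRealProdCLM with he
  have hb : Bornology.IsBounded (e ⁻¹' V) := by
    rw [← e.image_symm_eq_preimage]
    exact e.symm.lipschitz.isBounded_image hV
  have hsub := Complex.subset_range_of_eqOn_frontier hb (r := e.symm ∘ r ∘ e)
    (by fun_prop) (fun z hz => by
      have hz' : e z ∈ frontier V := by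
        have := e.toHomeomorph.preimage_frontier V
        exact this.symm.subset hz
      simp [hfix _ hz'])
  intro p hp
  obtain ⟨z, hz⟩ := hsub (show e.symm p ∈ e ⁻¹' V by simpa using hp)
  exact ⟨e z, e.symm.injective hz⟩

/-- The union of two arcs sharing only their initial point is a retract of the ambient space. -/
theorem exists_retraction_of_two_arcs {X : Type} [TopologicalSpace X] [NormalSpace X] [T2Space X]
    {a b : Set.Icc (0 : ℝ) 1 → X} (ha : Continuous a) (hb : Continuous b)
    (hai : Function.Injective a) (hbi : Function.Injective b) (h0 : a 0 = b 0)
    (hab : Set.range a ∩ Set.range b ⊆ {a 0}) :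
    ∃ r : X → X, Continuous r ∧ Set.range r ⊆ Set.range a ∪ Set.range b ∧
      ∀ x ∈ Set.range a ∪ Set.range b, r x = x := by
  have h01 : (0 : ℝ) ≤ 1 := zero_le_one
  set γ : ℝ → X := fun t =>
    if t ≤ 0 then a (Set.projIcc 0 1 h01 (-t)) else b (Set.projIcc 0 1 h01 t) with hγ
  have hγc : Continuous γ := by
    refine Continuous.if_le (ha.comp (continuous_projIcc.comp continuous_neg))
      (hb.comp continuous_projIcc) continuous_id continuous_const ?_
    rintro t rfl
    simpa [Set.projIcc_left] using h0
  have hγr : Set.range γ ⊆ Set.range a ∪ Set.range b := by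
    rintro _ ⟨t, rfl⟩
    by_cases ht : t ≤ 0
    · exact Or.inl ⟨_, (if_pos ht).symm⟩
    · exact Or.inr ⟨_, (if_neg ht).symm⟩
  have hγa : ∀ s : Set.Icc (0 : ℝ) 1, γ (-s) = a s := by
    intro s
    have : -(s : ℝ) ≤ 0 := neg_nonpos.2 s.2.1
    simp only [hγ, if_pos this, neg_neg, Set.projIcc_val]
  have hγb : ∀ s : Set.Icc (0 : ℝ) 1, γ s = b s := by
    intro s
    rcases s.2.1.eq_or_lt with hs | hs
    · obtain rfl : s = 0 := Subtype.ext hs.symm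
      rw [← h0, ← hγa]
      simp
    · simp only [hγ, if_neg hs.not_ge, Set.projIcc_val]
  have hcross : ∀ s t : Set.Icc (0 : ℝ) 1, a s = b t → s = 0 ∧ t = 0 := by
    intro s t hst
    have h : a s = a 0 := hab ⟨⟨s, rfl⟩, ⟨t, hst.symm⟩⟩
    exact ⟨hai h, hbi (by rw [← hst, h, h0])⟩
  have hcase : ∀ s : Set.Icc (-1 : ℝ) 1,
      (∃ u : Set.Icc (0 : ℝ) 1, (s : ℝ) = -u) ∨ ∃ u : Set.Icc (0 : ℝ) 1, (s : ℝ) = u := by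
    intro s
    rcases le_total (s : ℝ) 0 with hs | hs
    · exact Or.inl ⟨⟨-s, by linarith, by linarith [s.2.1]⟩, by simp⟩
    · exact Or.inr ⟨⟨s, hs, s.2.2⟩, rfl⟩
  have hinj : Function.Injective fun s : Set.Icc (-1 : ℝ) 1 => γ s := by
    intro s t hst
    apply Subtype.ext
    simp only at hst
    rcases hcase s with ⟨u, hu⟩ | ⟨u, hu⟩ <;> rcases hcase t with ⟨v, hv⟩ | ⟨v, hv⟩ <;>
      rw [hu, hv] at hst ⊢ <;> simp only [hγa, hγb] at hst
    · rw [hai hst]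
    · obtain ⟨rfl, rfl⟩ := hcross _ _ hst
      simp
    · obtain ⟨rfl, rfl⟩ := hcross _ _ hst.symm
      simp
    · rw [hbi hst]
  have hemb : Topology.IsClosedEmbedding fun s : Set.Icc (-1 : ℝ) 1 => γ s :=
    (hγc.comp continuous_subtype_val).isClosedEmbedding hinj
  obtain ⟨g, hg⟩ := ContinuousMap.exists_extension' hemb
    (⟨Subtype.val, continuous_subtype_val⟩ : C(Set.Icc (-1 : ℝ) 1, ℝ))
  have hfix : ∀ s ∈ Set.Icc (-1 : ℝ) 1, γ (g (γ s)) = γ s := fun s hs =>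
    congrArg γ (congrFun hg ⟨s, hs⟩)
  refine ⟨γ ∘ g, hγc.comp g.continuous, (Set.range_comp_subset_range _ _).trans hγr, ?_⟩
  rintro _ (⟨s, rfl⟩ | ⟨s, rfl⟩)
  · rw [← hγa]
    exact hfix _ ⟨by linarith [s.2.2], by linarith [s.2.1]⟩
  · rw [← hγb]
    exact hfix _ ⟨by linarith [s.2.1], by linarith [s.2.2]⟩

section Inside

variable {F : Type*} [NormedAddCommGroup F]

/-- The union of the bounded components of the complement of `K`. -/
def boundedComplement (K : Set F) : Set F :=
  {p | p ∉ K ∧ Bornology.IsBounded (connectedComponentIn Kᶜ p)}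

/-- The union of the unbounded components of the complement of `K`. -/
def unboundedComplement (K : Set F) : Set F :=
  {p | p ∉ K ∧ ¬ Bornology.IsBounded (connectedComponentIn Kᶜ p)}

theorem unboundedComplement_union_self (K : Set F) :
    unboundedComplement K ∪ K = (boundedComplement K)ᶜ := by
  ext p
  by_cases hp : p ∈ K <;> simp [unboundedComplement, boundedComplement, hp]

theorem mem_boundedComplement_of_mem_component {K : Set F} {p q : F}
    (hp : p ∈ boundedComplement K) (hq : q ∈ connectedComponentIn Kᶜ p) :
    q ∈ boundedComplement K :=
  ⟨connectedComponentIn_subset _ _ hq, connectedComponentIn_eq hq ▸ hp.2⟩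

theorem mem_unboundedComplement_of_mem_component {K : Set F} {p q : F}
    (hp : p ∈ unboundedComplement K) (hq : q ∈ connectedComponentIn Kᶜ p) :
    q ∈ unboundedComplement K :=
  ⟨connectedComponentIn_subset _ _ hq, connectedComponentIn_eq hq ▸ hp.2⟩

theorem isOpen_boundedComplement [NormedSpace ℝ F] {K : Set F} (hK : IsClosed K) :
    IsOpen (boundedComplement K) :=
  isOpen_iff_mem_nhds.2 fun _ hp => Filter.mem_of_superset
    (connectedComponentIn_mem_nhds (hK.isOpen_compl.mem_nhds hp.1))
    fun _ => mem_boundedComplement_of_mem_component hp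

theorem isOpen_unboundedComplement [NormedSpace ℝ F] {K : Set F} (hK : IsClosed K) :
    IsOpen (unboundedComplement K) :=
  isOpen_iff_mem_nhds.2 fun _ hp => Filter.mem_of_superset
    (connectedComponentIn_mem_nhds (hK.isOpen_compl.mem_nhds hp.1))
    fun _ => mem_unboundedComplement_of_mem_component hp

theorem isBounded_boundedComplement [NormedSpace ℝ F] {K : Set F} (hK : Bornology.IsBounded K) :
    Bornology.IsBounded (boundedComplement K) := by
  obtain ⟨R, hR, hKR⟩ := hK.subset_closedBall_lt 0 0
  refine (Metric.isBounded_closedBall (x := (0 : F)) (r := R)).subset fun p hp => ?_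
  by_contra hpR
  have hpR : R < ‖p‖ := by simpa using hpR
  have hray : (fun t : ℝ => t • p) '' Set.Ici 1 ⊆ connectedComponentIn Kᶜ p := by
    refine IsPreconnected.subset_connectedComponentIn ?_ ⟨1, by simp, by simp⟩ ?_
    · exact isPreconnected_Ici.image _ (by fun_prop)
    · rintro _ ⟨t, ht, rfl⟩ htK
      have h1 : ‖t • p‖ ≤ R := by simpa using hKR htK
      rw [norm_smul, Real.norm_eq_abs] at h1
      have h2 : (1 : ℝ) ≤ |t| := ht.out.trans (le_abs_self t)
      nlinarith
  obtain ⟨M, hM⟩ := (hp.2.subset hray).exists_norm_le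
  have h := hM _ ⟨max 1 ((M + 1) / R), Set.mem_Ici.2 (le_max_left _ _), rfl⟩
  simp only [norm_smul, Real.norm_eq_abs] at h
  have h1 : (M + 1) / R ≤ |max 1 ((M + 1) / R)| := (le_max_right _ _).trans (le_abs_self _)
  have h2 : M + 1 ≤ |max 1 ((M + 1) / R)| * R := (div_le_iff₀ hR).1 h1
  nlinarith [abs_nonneg (max 1 ((M + 1) / R))]

/-- Adding to `A ∪ B` a set enclosed by it and deleting `B` preserves the unbounded components. -/
theorem unboundedComplement_subset {A B D : Set F} (hD : D ⊆ A ∪ boundedComplement (A ∪ B)) :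
    unboundedComplement (A ∪ B) ⊆ unboundedComplement (A ∪ D) := by
  intro p hp
  have hsub : connectedComponentIn (A ∪ B)ᶜ p ⊆ (A ∪ D)ᶜ := by
    rintro q hq hqAD
    have hq' := mem_unboundedComplement_of_mem_component hp hq
    have hqA : q ∉ A := fun h => hq'.1 (Or.inl h)
    rcases hD (hqAD.resolve_left hqA) with h | h
    · exact hqA h
    · exact hq'.2 h.2
  have hmem : p ∈ connectedComponentIn (A ∪ B)ᶜ p := mem_connectedComponentIn hp.1
  exact ⟨hsub hmem, fun hb => hp.2 (hb.subset
    (isPreconnected_connectedComponentIn.subset_connectedComponentIn hmem hsub))⟩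

end Inside

/-- In a theta-like configuration with `A` a retract of the plane, two of the arms `B`, `D` cannot
each be enclosed by the union of the other one with `A`. -/
theorem theta_arm_subset {A B D : Set (ℝ × ℝ)} (hA : IsCompact A) (hB : IsCompact B)
    (hD : IsCompact D) (hBD : B ∩ D ⊆ A) (hDin : D ⊆ A ∪ boundedComplement (A ∪ B))
    (hBin : B ⊆ A ∪ boundedComplement (A ∪ D)) {r : ℝ × ℝ → ℝ × ℝ} (hr : Continuous r)
    (hrange : Set.range r ⊆ A) (hfix : ∀ x ∈ A, r x = x) : D ⊆ A := by
  set U := unboundedComplement (A ∪ B) with hU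
  have hUeq : U = unboundedComplement (A ∪ D) :=
    (unboundedComplement_subset hDin).antisymm (unboundedComplement_subset hBin)
  have hclosure : ∀ {K : Set (ℝ × ℝ)}, IsClosed K →
      closure (unboundedComplement K) ⊆ unboundedComplement K ∪ K := by
    intro K hK
    refine closure_minimal Set.subset_union_left ?_
    rw [unboundedComplement_union_self]
    exact (isOpen_boundedComplement hK).isClosed_compl
  have hUopen : IsOpen U := isOpen_unboundedComplement (hA.union hB).isClosed
  have hUcl : closure U ⊆ U ∪ A := by
    intro p hp
    by_contra hpn
    obtain ⟨hpU, hpA⟩ := not_or.1 hpn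
    have h1 := (hclosure (hA.union hB).isClosed hp).resolve_left hpU
    have h2 := (hclosure (hA.union hD).isClosed (hUeq ▸ hp)).resolve_left (hUeq ▸ hpU)
    exact hpA (hBD ⟨h1.resolve_left hpA, h2.resolve_left hpA⟩)
  have hfront : frontier (U ∪ A)ᶜ ⊆ A := by
    rw [frontier_compl]
    intro p hp
    have hp1 : p ∈ U ∪ A := by
      have := frontier_subset_closure hp
      rw [closure_union, hA.isClosed.closure_eq] at this
      exact this.elim (fun h => hUcl h) Or.inr
    refine hp1.resolve_left fun hpU => hp.2 ?_
    exact interior_mono Set.subset_union_left (hUopen.interior_eq.symm ▸ hpU)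
  have hbdd : Bornology.IsBounded (U ∪ A)ᶜ := by
    refine ((isBounded_boundedComplement (hA.union hB).isBounded).union
      (hA.union hB).isBounded).subset fun p hp => ?_
    by_contra hpn
    obtain ⟨hpI, hpK⟩ := not_or.1 hpn
    have hpU : p ∈ U ∪ (A ∪ B) := (unboundedComplement_union_self (A ∪ B)).symm ▸ hpI
    exact hp (Or.inl (hpU.resolve_right hpK))
  have hVA := (subset_range_of_eqOn_frontier hbdd hr fun z hz => hfix z (hfront hz)).trans hrange
  intro p hp
  by_contra hpA
  refine hpA (hVA ?_)
  rintro (hpU | h)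
  · exact hpU.2 ((hDin hp).resolve_left hpA).2
  · exact hpA h

namespace PlaneEmbedding

variable {V : Type} {G : SimpleGraph V} (E : PlaneEmbedding G)

theorem pos_mem_arc_left {u v : V} (h : G.Adj u v) : E.pos u ∈ Set.range (E.arc u v) :=
  ⟨_, E.arc_start u v h⟩

theorem pos_mem_arc_right {u v : V} (h : G.Adj u v) : E.pos v ∈ Set.range (E.arc u v) :=
  ⟨_, E.arc_end u v h⟩

theorem isCompact_range_arc {u v : V} (h : G.Adj u v) : IsCompact (Set.range (E.arc u v)) :=
  isCompact_range (E.arc_cont u v h)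

/-- The edge from `u` to `v` meets an edge not containing `v` at most in `u`. -/
theorem arc_inter_arc_subset {u v a b : V} (huv : G.Adj u v) (hab : G.Adj a b) (hva : v ≠ a)
    (hvb : v ≠ b) : Set.range (E.arc u v) ∩ Set.range (E.arc a b) ⊆ {E.pos u} := by
  have hne : ({u, v} : Set V) ≠ {a, b} := fun h => by
    have : v ∈ ({a, b} : Set V) := h ▸ Or.inr rfl
    exact this.elim hva hvb
  intro p hp
  obtain ⟨x, ⟨hx1, hx2⟩, rfl⟩ := E.arcs_meet_only_at_endpoints u v a b huv hab hne hp
  rcases hx1 with rfl | rfl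
  · rfl
  · exact (hx2.elim hva hvb).elim

/-- An edge meeting `K` at most in its initial point lies, apart from that point, in the component
of the final point. -/
theorem arc_subset_component {u v : V} (h : G.Adj u v) {K : Set (ℝ × ℝ)}
    (hK : Set.range (E.arc u v) ∩ K ⊆ {E.pos u}) :
    Set.range (E.arc u v) ⊆ {E.pos u} ∪ connectedComponentIn Kᶜ (E.pos v) := by
  have hconn : IsPreconnected (E.arc u v '' Set.Ioi 0) :=
    isPreconnected_Ioi.image _ (E.arc_cont u v h).continuousOn
  have hsub := hconn.subset_connectedComponentIn (x := E.pos v) (F := Kᶜ)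
    ⟨1, Set.mem_Ioi.2 zero_lt_one, E.arc_end u v h⟩ (by
      rintro _ ⟨t, ht, rfl⟩ htK
      have h0 : E.arc u v t = E.arc u v 0 := (hK ⟨⟨t, rfl⟩, htK⟩).trans (E.arc_start u v h).symm
      exact (Set.mem_Ioi.1 ht).ne' (E.arc_inj u v h h0))
  rintro _ ⟨t, rfl⟩
  rcases eq_or_ne t 0 with rfl | ht
  · exact Or.inl (E.arc_start u v h)
  · exact Or.inr (hsub ⟨t, Set.mem_Ioi.2 (lt_of_le_of_ne t.2.1 (Ne.symm ht)), rfl⟩)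

theorem insideQuad_eq (a b c d : V) :
    E.insideQuad a b c d = boundedComplement (Set.range (E.arc a b) ∪ Set.range (E.arc b c) ∪
      (Set.range (E.arc c d) ∪ Set.range (E.arc d a))) := by
  rw [← Set.union_assoc]
  rfl

/-- An edge from a vertex of a 4-cycle to a vertex inside it is enclosed by the 4-cycle. -/
theorem arc_subset_of_mem_insideQuad {a b c d e u : V} (hq : G.IsQuad a b c d)
    (he : E.pos e ∈ E.insideQuad a b c d) (hea : e ≠ a) (heb : e ≠ b) (hec : e ≠ c) (hed : e ≠ d)
    (hu : G.Adj u e) : Set.range (E.arc u e) ⊆ {E.pos u} ∪ E.insideQuad a b c d := by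
  obtain ⟨hab, hbc, hcd, hda, -⟩ := hq
  refine (E.arc_subset_component hu (K := E.quadDrawing a b c d) ?_).trans
    (Set.union_subset_union_right _ fun q => mem_boundedComplement_of_mem_component he)
  rintro p ⟨hp, ((h | h) | h) | h⟩
  · exact E.arc_inter_arc_subset hu hab hea heb ⟨hp, h⟩
  · exact E.arc_inter_arc_subset hu hbc heb hec ⟨hp, h⟩
  · exact E.arc_inter_arc_subset hu hcd hec hed ⟨hp, h⟩
  · exact E.arc_inter_arc_subset hu hda hed hea ⟨hp, h⟩

/-- Two paths `a b c` and `a e c` enclosing a path `a d c`: all of the latter's points lie on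
`a b c` or inside the 4-cycle `a b c e`. -/
theorem path_subset_of_mem_insideQuad {a b c d e : V} (hq : G.IsQuad a b c e)
    (hd : E.pos d ∈ E.insideQuad a b c e) (hda : d ≠ a) (hdb : d ≠ b) (hdc : d ≠ c) (hde : d ≠ e)
    (hcd : G.Adj c d) (had : G.Adj d a) :
    Set.range (E.arc c d) ∪ Set.range (E.arc d a) ⊆
      Set.range (E.arc a b) ∪ Set.range (E.arc b c) ∪ E.insideQuad a b c e := by
  refine Set.union_subset ?_ ?_
  · refine (E.arc_subset_of_mem_insideQuad hq hd hda hdb hdc hde hcd).trans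
      (Set.union_subset_union_left _ ?_)
    exact Set.singleton_subset_iff.2 (Or.inr (E.pos_mem_arc_right hq.2.1))
  · rw [E.arc_symm _ _ had]
    refine (E.arc_subset_of_mem_insideQuad hq hd hda hdb hdc hde had.symm).trans
      (Set.union_subset_union_left _ ?_)
    exact Set.singleton_subset_iff.2 (Or.inl (E.pos_mem_arc_left hq.1))

theorem exists_retraction_path {a b c : V} (hab : G.Adj a b) (hbc : G.Adj b c) (hac : a ≠ c) :
    ∃ r : ℝ × ℝ → ℝ × ℝ, Continuous r ∧
      Set.range r ⊆ Set.range (E.arc a b) ∪ Set.range (E.arc b c) ∧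
      ∀ x ∈ Set.range (E.arc a b) ∪ Set.range (E.arc b c), r x = x := by
  rw [E.arc_symm a b hab]
  have h0 : E.arc b a 0 = E.pos b := E.arc_start b a hab.symm
  refine exists_retraction_of_two_arcs (E.arc_cont _ _ hab.symm) (E.arc_cont _ _ hbc)
    (E.arc_inj _ _ hab.symm) (E.arc_inj _ _ hbc) (h0.trans (E.arc_start b c hbc).symm) ?_
  rw [h0]
  exact E.arc_inter_arc_subset hab.symm hbc hab.ne hac

/-- Of two paths `a d c` and `a e c`, at most one is enclosed by `a b c` and the other one. -/
theorem notMem_insideQuad_of_mem_insideQuad {a b c d e : V} (hqd : G.IsQuad a b c d)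
    (hqe : G.IsQuad a b c e) (hde : d ≠ e) (he : E.pos e ∈ E.insideQuad a b c d) :
    E.pos d ∉ E.insideQuad a b c e := by
  intro hd
  have ⟨hab, hbc, hcd, hda, _, hac, nad, _, nbd, ncd⟩ := hqd
  have ⟨_, _, hce, hea, _, _, nae, _, nbe, nce⟩ := hqe
  obtain ⟨r, hr, hrange, hfix⟩ := E.exists_retraction_path hab hbc hac
  have hein := E.path_subset_of_mem_insideQuad hqd he nae.symm nbe.symm nce.symm hde.symm hce hea
  have hdin := E.path_subset_of_mem_insideQuad hqe hd nad.symm nbd.symm ncd.symm hde hcd hda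
  rw [insideQuad_eq] at hein hdin
  have ha : ({E.pos a} : Set (ℝ × ℝ)) ⊆ Set.range (E.arc a b) ∪ Set.range (E.arc b c) :=
    Set.singleton_subset_iff.2 (Or.inl (E.pos_mem_arc_left hab))
  have hc : ({E.pos c} : Set (ℝ × ℝ)) ⊆ Set.range (E.arc a b) ∪ Set.range (E.arc b c) :=
    Set.singleton_subset_iff.2 (Or.inr (E.pos_mem_arc_right hbc))
  have hmeet : (Set.range (E.arc c d) ∪ Set.range (E.arc d a)) ∩
      (Set.range (E.arc c e) ∪ Set.range (E.arc e a)) ⊆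
      Set.range (E.arc a b) ∪ Set.range (E.arc b c) := by
    rw [E.arc_symm d a hda]
    rintro p ⟨h | h, h' | h'⟩
    · exact hc (E.arc_inter_arc_subset hcd hce ncd.symm hde ⟨h, h'⟩)
    · exact hc (E.arc_inter_arc_subset hcd hea hde nad.symm ⟨h, h'⟩)
    · exact ha (E.arc_inter_arc_subset hda.symm hce ncd.symm hde ⟨h, h'⟩)
    · exact ha (E.arc_inter_arc_subset hda.symm hea hde nad.symm ⟨h, h'⟩)
  have hsub := theta_arm_subset ((E.isCompact_range_arc hab).union (E.isCompact_range_arc hbc))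
    ((E.isCompact_range_arc hcd).union (E.isCompact_range_arc hda))
    ((E.isCompact_range_arc hce).union (E.isCompact_range_arc hea)) hmeet hein hdin hr hrange hfix
  rcases hsub (Or.inl (E.pos_mem_arc_right hce)) with h | h
  · exact E.arc_avoid _ _ _ hab nae.symm nbe.symm h
  · exact E.arc_avoid _ _ _ hbc nbe.symm nce.symm h

theorem ne_of_mem_insideQuad {a b c d e : V} (hq : G.IsQuad a b c d)
    (he : E.pos e ∈ E.insideQuad a b c d) : e ≠ a ∧ e ≠ b ∧ e ≠ c ∧ e ≠ d := by
  obtain ⟨hab, -, hcd, -⟩ := hq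
  refine ⟨?_, ?_, ?_, ?_⟩ <;> rintro rfl <;> apply he.1
  · exact Or.inl (Or.inl (Or.inl (E.pos_mem_arc_left hab)))
  · exact Or.inl (Or.inl (Or.inl (E.pos_mem_arc_right hab)))
  · exact Or.inl (Or.inr (E.pos_mem_arc_left hcd))
  · exact Or.inl (Or.inr (E.pos_mem_arc_right hcd))

theorem pos_notMem_quadDrawing {a b c d e : V} (hq : G.IsQuad a b c d) (hea : e ≠ a)
    (heb : e ≠ b) (hec : e ≠ c) (hed : e ≠ d) : E.pos e ∉ E.quadDrawing a b c d := by
  obtain ⟨hab, hbc, hcd, hda, -⟩ := hq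
  rintro (((h | h) | h) | h)
  · exact E.arc_avoid _ _ _ hab hea heb h
  · exact E.arc_avoid _ _ _ hbc heb hec h
  · exact E.arc_avoid _ _ _ hcd hec hed h
  · exact E.arc_avoid _ _ _ hda hed hea h

end PlaneEmbedding

/-- in a plane graph whose outer boundary is a cycle and which has no
separating 4-cycle, if `w` lies inside a 4-cycle `x₁x₂x₃x₄` and is adjacent to `x₁, x₃`,
then the interior of the 4-cycle `x₁x₂x₃w` contains no vertex of `G`. -/
theorem no_vertex_inside_quad {V : Type} [Fintype V] (G : SimpleGraph V)
    (E : PlaneEmbedding G)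
    (hbd : ∃ (v : V) (c : G.Walk v v), c.IsCycle ∧
      ∀ x, x ∈ c.support ↔ E.OnOuterBoundary x)
    (hnosep : ¬ ∃ a b c d : V, G.IsQuad a b c d ∧
      (∃ z, E.pos z ∈ E.insideQuad a b c d) ∧ (∃ z, E.pos z ∈ E.outsideQuad a b c d))
    (x₁ x₂ x₃ x₄ w : V) (hq : G.IsQuad x₁ x₂ x₃ x₄)
    (hwin : E.pos w ∈ E.insideQuad x₁ x₂ x₃ x₄)
    (hw1 : G.Adj w x₁) (hw3 : G.Adj w x₃) :
    ∀ z : V, E.pos z ∉ E.insideQuad x₁ x₂ x₃ w := by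
  intro z hz
  obtain ⟨n1, n2, n3, n4⟩ := E.ne_of_mem_insideQuad hq hwin
  have ⟨h12, h23, _, _, m12, m13, m14, m23, m24, m34⟩ := hq
  have hq' : G.IsQuad x₁ x₂ x₃ w :=
    ⟨h12, h23, hw3.symm, hw1, m12, m13, n1.symm, m23, n2.symm, n3.symm⟩
  have hout := E.pos_notMem_quadDrawing hq' m14.symm m24.symm m34.symm n4.symm
  exact hnosep ⟨x₁, x₂, x₃, w, hq', ⟨z, hz⟩, x₄, hout, fun hb =>
    E.notMem_insideQuad_of_mem_insideQuad hq hq' n4.symm hwin ⟨hout, hb⟩⟩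
end

section
/- Every planar graph is 5-choosable: for every list assignment L with |L(v)| ≥ 5 for all vertices v, a planar graph G admits a proper L-colouring (Thomassen's theorem). -/
section LogarithmicVariation

/-- The variation `f 1 - f 0` of a continuous logarithm `f` of `γ - q`. -/
noncomputable def logVariation (q : ℂ) (γ : ℝ → ℂ) : ℂ :=
  open Classical in
  if h : ∃ f : ℝ → ℂ, Continuous f ∧ ∀ t, Complex.exp (f t) = γ t - q then
    h.choose 1 - h.choose 0
  else 0

theorem exists_continuous_log_s16 {E : Type} [AddCommGroup E] [Module ℝ E] [TopologicalSpace E]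
    [IsTopologicalAddGroup E] [ContinuousSMul ℝ E] [LocallyPathConnectedSpace E]
    {g : E → ℂ} (hg : Continuous g) (h0 : ∀ x, g x ≠ 0) :
    ∃ f : E → ℂ, Continuous f ∧ ∀ x, Complex.exp (f x) = g x := by
  have : ContractibleSpace E := RealTopologicalVectorSpace.contractibleSpace
  obtain ⟨f, ⟨-, hf⟩, -⟩ := Complex.isCoveringMapOn_exp.existsUnique_continuousMap_lifts
    ⟨g, hg⟩ (a₀ := 0) (Complex.exp_log (h0 0)) h0
  exact ⟨f, f.continuous, fun x => congrFun hf x⟩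

theorem sub_eq_sub_of_exp_eq_mul_exp {f g : ℝ → ℂ} (hf : Continuous f) (hg : Continuous g) {c : ℂ}
    (h : ∀ t, Complex.exp (f t) = c * Complex.exp (g t)) (s t : ℝ) :
    f t - f s = g t - g s := by
  have := Complex.isCoveringMap_exp.const_of_comp (hf.sub hg)
    (fun a b => Subtype.ext (by simp [Complex.exp_sub, h])) s t
  simp only [Pi.sub_apply] at this
  linear_combination -this

theorem logVariation_eq {q : ℂ} {γ f : ℝ → ℂ} {c : ℂ} (hc : c ≠ 0) (hf : Continuous f)
    (h : ∀ t, Complex.exp (f t) = c * (γ t - q)) : logVariation q γ = f 1 - f 0 := by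
  have hex : ∃ f : ℝ → ℂ, Continuous f ∧ ∀ t, Complex.exp (f t) = γ t - q :=
    ⟨fun t => f t - Complex.log c, hf.sub continuous_const, fun t => by
      rw [Complex.exp_sub, h, Complex.exp_log hc, mul_div_cancel_left₀ _ hc]⟩
  rw [logVariation, dif_pos hex]
  refine (sub_eq_sub_of_exp_eq_mul_exp hf hex.choose_spec.1 (c := c) (fun t => ?_) 0 1).symm
  rw [h, hex.choose_spec.2]

theorem logVariation_square {x y : ℝ → ℂ} (hx : Continuous x) (hy : Continuous y)
    (hxy : ∀ s t, x s ≠ y t) :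
    logVariation (x 0) y + logVariation (y 1) x = logVariation (y 0) x + logVariation (x 1) y := by
  obtain ⟨f, hf, hfe⟩ := exists_continuous_log_s16 (E := ℝ × ℝ) (g := fun r => x r.1 - y r.2)
    (by fun_prop) (fun r => sub_ne_zero.2 (hxy _ _))
  have hl (s : ℝ) : logVariation (x s) y = f (s, 1) - f (s, 0) :=
    logVariation_eq (f := fun t => f (s, t)) (c := -1) (by simp) (by fun_prop)
      (fun t => by rw [hfe]; ring)
  have hr (t : ℝ) : logVariation (y t) x = f (1, t) - f (0, t) :=
    logVariation_eq (f := fun s => f (s, t)) (c := 1) (by simp) (by fun_prop)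
      (fun s => by rw [hfe]; ring)
  rw [hl, hl, hr, hr]
  ring

theorem exists_logVariation_eq {q : ℂ} {γ : ℝ → ℂ} (hγ : Continuous γ) (h : ∀ t, γ t ≠ q) :
    ∃ n : ℤ, logVariation q γ = Complex.log (γ 1 - q) - Complex.log (γ 0 - q)
      + n * (2 * Real.pi * Complex.I) := by
  obtain ⟨f, hf, hfe⟩ := exists_continuous_log_s16 (g := fun t => γ t - q) (by fun_prop)
    (fun t => sub_ne_zero.2 (h t))
  rw [logVariation_eq (c := 1) one_ne_zero hf (by simpa using hfe)]
  obtain ⟨a, ha⟩ := Complex.exp_eq_exp_iff_exists_int.1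
    ((hfe 1).trans (Complex.exp_log (sub_ne_zero.2 (h 1))).symm)
  obtain ⟨b, hb⟩ := Complex.exp_eq_exp_iff_exists_int.1
    ((hfe 0).trans (Complex.exp_log (sub_ne_zero.2 (h 0))).symm)
  refine ⟨a - b, ?_⟩
  rw [ha, hb]
  push_cast
  ring

theorem exists_log_neg_eq {z : ℂ} (hz : z ≠ 0) :
    ∃ m : ℤ, Complex.log (-z) = Complex.log z + (2 * m + 1) * (Real.pi * Complex.I) := by
  obtain ⟨m, hm⟩ := Complex.exp_eq_exp_iff_exists_int.1
    (show Complex.exp (Complex.log (-z)) = Complex.exp (Complex.log z + Real.pi * Complex.I) by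
      rw [Complex.exp_log (neg_ne_zero.2 hz), Complex.exp_add, Complex.exp_log hz,
        Complex.exp_pi_mul_I]
      ring)
  refine ⟨m, ?_⟩
  rw [hm]
  ring

/-- Two disjoint paths, one from `p u` to `p v` and one from `p w` to `p z`, yield a linear relation
between integers: the numbers `e` compare the arguments of `p b - p a` and `p a - p b`, and
`n a b c` counts the turns of the path from `p b` to `p c` around `p a`. -/
theorem exists_turning_numbers {ι : Type} {p : ι → ℂ} (hp : Function.Injective p)
    {γ : ι → ι → ℝ → ℂ} (hγ : ∀ u v, Continuous (γ u v)) (K : SimpleGraph ι)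
    (h0 : ∀ u v, K.Adj u v → γ u v 0 = p u) (h1 : ∀ u v, K.Adj u v → γ u v 1 = p v)
    (hd : ∀ u v w z, K.Adj u v → K.Adj w z → u ≠ w → u ≠ z → v ≠ w → v ≠ z →
      ∀ s t, γ u v s ≠ γ w z t) :
    ∃ (e : ι → ι → ℤ) (n : ι → ι → ι → ℤ), (∀ a b, a ≠ b → Odd (e a b)) ∧
      (∀ a b, e b a = - e a b) ∧
      ∀ u v w z, K.Adj u v → K.Adj w z → u ≠ w → u ≠ z → v ≠ w → v ≠ z →
        e u w + e v z - e u z - e v w + 2 * (n u w z + n z u v - n w u v - n v w z) = 0 := by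
  have hpi : (Real.pi * Complex.I : ℂ) ≠ 0 := by simp [Real.pi_ne_zero]
  have he : ∀ a b, ∃ e : ℤ, (a ≠ b → Odd e) ∧
      Complex.log (p a - p b) - Complex.log (p b - p a) = e * (Real.pi * Complex.I) := by
    intro a b
    by_cases hab : a = b
    · exact ⟨0, by simp [hab]⟩
    · obtain ⟨m, hm⟩ := exists_log_neg_eq (sub_ne_zero.2 fun h => hab (hp h).symm)
      refine ⟨2 * m + 1, fun _ => ⟨m, rfl⟩, ?_⟩
      rw [← neg_sub (p b), hm]
      push_cast
      ring
  have hn : ∀ a b c, ∃ n : ℤ, (K.Adj b c ∧ ∀ t, γ b c t ≠ p a) →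
      logVariation (p a) (γ b c) = Complex.log (p c - p a) - Complex.log (p b - p a)
        + n * (2 * Real.pi * Complex.I) := by
    intro a b c
    by_cases h : K.Adj b c ∧ ∀ t, γ b c t ≠ p a
    · obtain ⟨n, hn⟩ := exists_logVariation_eq (hγ b c) h.2
      rw [h0 b c h.1, h1 b c h.1] at hn
      exact ⟨n, fun _ => hn⟩
    · exact ⟨0, fun h' => absurd h' h⟩
  choose e heo he using he
  choose n hn using hn
  refine ⟨e, n, heo, fun a b => ?_, ?_⟩
  · have : (e b a : ℂ) * (Real.pi * Complex.I) = (-e a b : ℤ) * (Real.pi * Complex.I) := by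
      push_cast
      linear_combination - he a b - he b a
    exact_mod_cast mul_right_cancel₀ hpi this
  · intro u v w z huv hwz h₁ h₂ h₃ h₄
    have hdis := hd u v w z huv hwz h₁ h₂ h₃ h₄
    have hsq := logVariation_square (hγ u v) (hγ w z) hdis
    rw [h0 _ _ huv, h0 _ _ hwz, h1 _ _ huv, h1 _ _ hwz,
      hn u w z ⟨hwz, fun t => h0 _ _ huv ▸ (hdis 0 t).symm⟩,
      hn z u v ⟨huv, fun t => h1 _ _ hwz ▸ hdis t 1⟩,
      hn w u v ⟨huv, fun t => h0 _ _ hwz ▸ hdis t 0⟩,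
      hn v w z ⟨hwz, fun t => h1 _ _ huv ▸ (hdis 1 t).symm⟩] at hsq
    have key : ((e u w + e v z - e u z - e v w
        + 2 * (n u w z + n z u v - n w u v - n v w z) : ℤ) : ℂ) * (Real.pi * Complex.I)
        = (0 : ℤ) * (Real.pi * Complex.I) := by
      push_cast
      linear_combination hsq - he u w - he v z + he u z + he v w
    exact_mod_cast mul_right_cancel₀ hpi key

end LogarithmicVariation

section MinorModels

variable {V ι : Type}

/-- `B` assigns to the vertices of `K` disjoint connected vertex sets of `G` exhibiting `K` as a
minor of `G`. -/
structure IsMinorModel (G : SimpleGraph V) (K : SimpleGraph ι) (B : ι → Set V) : Prop where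
  connected : ∀ i, (G.induce (B i)).Connected
  disjoint : ∀ i j, i ≠ j → Disjoint (B i) (B j)
  adj : ∀ i j, K.Adj i j → ∃ a ∈ B i, ∃ b ∈ B j, G.Adj a b

namespace PlaneEmbedding

variable {G : SimpleGraph V}

/-- The part of the drawing spanned by the vertices in `S`. -/
def region (φ : PlaneEmbedding G) (S : Set V) : Set (ℝ × ℝ) :=
  φ.pos '' S ∪ {x | ∃ a ∈ S, ∃ b ∈ S, G.Adj a b ∧ x ∈ Set.range (φ.arc a b)}

theorem disjoint_region (φ : PlaneEmbedding G) {S T : Set V} (h : Disjoint S T) :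
    Disjoint (φ.region S) (φ.region T) := by
  have hne : ∀ {a b}, a ∈ S → b ∈ T → a ≠ b := fun ha hb hab =>
    Set.disjoint_left.1 h ha (hab ▸ hb)
  rw [Set.disjoint_left]
  rintro _ (⟨a, ha, rfl⟩ | ⟨a, ha, b, hb, hab, hx⟩) (⟨c, hc, hcx⟩ | ⟨c, hc, d, hd, hcd, hy⟩)
  · exact hne ha hc (φ.pos_inj hcx).symm
  · exact φ.arc_avoid c d a hcd (hne ha hc) (hne ha hd) hy
  · exact φ.arc_avoid a b c hab (hne ha hc).symm (hne hb hc).symm (hcx ▸ hx)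
  · have hdisj : ({a, b} : Set V) ∩ {c, d} = ∅ := by
      ext z
      simp only [Set.mem_inter_iff, Set.mem_insert_iff, Set.mem_singleton_iff,
        Set.mem_empty_iff_false, iff_false]
      rintro ⟨rfl | rfl, rfl | rfl⟩
      exacts [hne ha hc rfl, hne ha hd rfl, hne hb hc rfl, hne hb hd rfl]
    have hpair : ({a, b} : Set V) ≠ {c, d} := by
      intro h
      rw [h, Set.inter_self] at hdisj
      exact (Set.insert_nonempty _ _).ne_empty hdisj
    have := φ.arcs_meet_only_at_endpoints a b c d hab hcd hpair ⟨hx, hy⟩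
    rw [hdisj, Set.image_empty] at this
    exact this

theorem joinedIn_region (φ : PlaneEmbedding G) {S : Set V} (hS : (G.induce S).Connected)
    {a b : V} (ha : a ∈ S) (hb : b ∈ S) : JoinedIn (φ.region S) (φ.pos a) (φ.pos b) := by
  obtain ⟨p⟩ := hS.preconnected ⟨a, ha⟩ ⟨b, hb⟩
  suffices ∀ {x y : S}, (G.induce S).Walk x y → JoinedIn (φ.region S) (φ.pos x) (φ.pos y) from
    this p
  intro x y p
  induction p with
  | nil => exact JoinedIn.refl (Or.inl ⟨_, Subtype.coe_prop _, rfl⟩)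
  | @cons u v w huv _ ih =>
    have huv' : G.Adj u v := huv
    refine JoinedIn.trans ⟨⟨⟨φ.arc u v, φ.arc_cont u v huv'⟩, φ.arc_start u v huv',
      φ.arc_end u v huv'⟩, fun t => Or.inr ⟨u, u.2, v, v.2, huv', t, rfl⟩⟩ ih

theorem exists_turning_numbers (φ : PlaneEmbedding G) {K : SimpleGraph ι} {B : ι → Set V}
    (hB : IsMinorModel G K B) :
    ∃ (e : ι → ι → ℤ) (n : ι → ι → ι → ℤ), (∀ a b, a ≠ b → Odd (e a b)) ∧
      (∀ a b, e b a = - e a b) ∧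
      ∀ u v w z, K.Adj u v → K.Adj w z → u ≠ w → u ≠ z → v ≠ w → v ≠ z →
        e u w + e v z - e u z - e v w + 2 * (n u w z + n z u v - n w u v - n v w z) = 0 := by
  have hr : ∀ i, ∃ r, r ∈ B i := fun i => Set.nonempty_coe_sort.1 (hB.connected i).nonempty
  choose r hr using hr
  let ψ : ℝ × ℝ → ℂ := Complex.equivRealProdCLM.symm
  have hψc : Continuous ψ := Complex.equivRealProdCLM.symm.continuous
  have hψi : Function.Injective ψ := Complex.equivRealProdCLM.symm.injective
  have hγ : ∀ u v, ∃ γ : ℝ → ℝ × ℝ, Continuous γ ∧ (K.Adj u v → γ 0 = φ.pos (r u) ∧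
      γ 1 = φ.pos (r v) ∧ ∀ t, γ t ∈ φ.region (B u ∪ B v)) := by
    intro u v
    by_cases h : K.Adj u v
    · obtain ⟨a, ha, b, hb, hab⟩ := hB.adj u v h
      have hj := φ.joinedIn_region (SimpleGraph.connected_induce_union
        (hB.connected u).preconnected (hB.connected v).preconnected ha hb hab)
        (Or.inl (hr u)) (Or.inr (hr v))
      exact ⟨hj.somePath.extend, hj.somePath.continuous_extend, fun _ =>
        ⟨by simp, by simp, fun t => hj.somePath_mem _⟩⟩
    · exact ⟨fun _ => 0, continuous_const, fun h' => absurd h' h⟩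
  choose γ hγc hγ using hγ
  refine _root_.exists_turning_numbers (p := fun i => ψ (φ.pos (r i)))
    (γ := fun u v t => ψ (γ u v t)) ?_ (fun u v => hψc.comp (hγc u v)) K
    (fun u v h => by simp [(hγ u v h).1]) (fun u v h => by simp [(hγ u v h).2.1]) ?_
  · intro i j hij
    by_contra hne
    exact Set.disjoint_left.1 (hB.disjoint i j hne) (hr i) (φ.pos_inj (hψi hij) ▸ hr j)
  · intro u v w z huv hwz h₁ h₂ h₃ h₄ s t hst
    have hd : Disjoint (B u ∪ B v) (B w ∪ B z) := by
      rw [Set.disjoint_union_left, Set.disjoint_union_right, Set.disjoint_union_right]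
      exact ⟨⟨hB.disjoint _ _ h₁, hB.disjoint _ _ h₂⟩, hB.disjoint _ _ h₃, hB.disjoint _ _ h₄⟩
    have hst' := hψi hst
    exact Set.disjoint_left.1 (φ.disjoint_region hd) ((hγ u v huv).2.2 s)
      (hst' ▸ (hγ w z hwz).2.2 t)

end PlaneEmbedding

namespace SimpleGraph.IsPlanar

variable {G : SimpleGraph V}

theorem not_isMinorModel_completeGraph_five (hG : G.IsPlanar) (B : Fin 5 → Set V) :
    ¬ IsMinorModel G (⊤ : SimpleGraph (Fin 5)) B := by
  intro hB
  obtain ⟨φ⟩ := hG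
  obtain ⟨e, n, ho, ha, H⟩ := φ.exists_turning_numbers hB
  have key : ∀ i j k l : Fin 5, i < j → j < k → k < l →
      Odd (n i k l + n l i j + n k i j + n j k l + n i j l + n l i k + n j i k + n k j l
        + n i j k + n k i l + n j i l + n l j k) := by
    intro i j k l hij hjk hkl
    have hik := hij.trans hjk
    have hil := hik.trans hkl
    have hjl := hjk.trans hkl
    have h₁ := H i j k l hij.ne hkl.ne hik.ne hil.ne hjk.ne hjl.ne
    have h₂ := H i k j l hik.ne hjl.ne hij.ne hil.ne hjk.ne' hkl.ne
    have h₃ := H i l j k hil.ne hjk.ne hij.ne hik.ne hjl.ne' hkl.ne'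
    rw [ha j k] at h₂
    rw [ha k l, ha j l] at h₃
    obtain ⟨a, ha⟩ := ho i j hij.ne
    obtain ⟨b, hb⟩ := ho j l hjl.ne
    obtain ⟨c, hc⟩ := ho i l hil.ne
    rw [Int.odd_iff]
    omega
  have k₀ := key 1 2 3 4 (by decide) (by decide) (by decide)
  have k₁ := key 0 2 3 4 (by decide) (by decide) (by decide)
  have k₂ := key 0 1 3 4 (by decide) (by decide) (by decide)
  have k₃ := key 0 1 2 4 (by decide) (by decide) (by decide)
  have k₄ := key 0 1 2 3 (by decide) (by decide) (by decide)
  clear key H ha ho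
  rw [Int.odd_iff] at k₀ k₁ k₂ k₃ k₄
  omega

theorem not_isMinorModel_completeBipartiteGraph_three (hG : G.IsPlanar)
    (B : Fin 3 ⊕ Fin 3 → Set V) :
    ¬ IsMinorModel G (completeBipartiteGraph (Fin 3) (Fin 3)) B := by
  intro hB
  obtain ⟨φ⟩ := hG
  obtain ⟨e, n, ho, ha, H⟩ := φ.exists_turning_numbers hB
  choose m hm using ho
  have key : ∀ i i' j j' : Fin 3, i < i' → j < j' →
      Odd (n (.inl i) (.inl i') (.inr j') + n (.inr j') (.inl i) (.inr j)
        + n (.inl i') (.inl i) (.inr j) + n (.inr j) (.inl i') (.inr j')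
        + n (.inl i) (.inl i') (.inr j) + n (.inr j) (.inl i) (.inr j')
        + n (.inl i') (.inl i) (.inr j') + n (.inr j') (.inl i') (.inr j)
        + m (.inl i) (.inr j) (by simp) + m (.inl i) (.inr j') (by simp)
        + m (.inl i') (.inr j) (by simp) + m (.inl i') (.inr j') (by simp)) := by
    intro i i' j j' hi hj
    have h₁ := H (.inl i) (.inr j) (.inl i') (.inr j') (by simp) (by simp) (by simp [hi.ne])
      (by simp) (by simp) (by simp [hj.ne])
    have h₂ := H (.inl i) (.inr j') (.inl i') (.inr j) (by simp) (by simp) (by simp [hi.ne])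
      (by simp) (by simp) (by simp [hj.ne'])
    rw [ha (.inl i') (.inr j)] at h₁
    rw [ha (.inl i') (.inr j'), ha (.inr j) (.inr j')] at h₂
    have e₁ := hm (.inl i) (.inl i') (by simp [hi.ne])
    have e₂ := hm (.inl i) (.inr j) (by simp)
    have e₃ := hm (.inl i) (.inr j') (by simp)
    have e₄ := hm (.inl i') (.inr j) (by simp)
    have e₅ := hm (.inl i') (.inr j') (by simp)
    rw [Int.odd_iff]
    omega
  have k₁ := key 0 1 0 1 (by decide) (by decide)
  have k₂ := key 0 1 0 2 (by decide) (by decide)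
  have k₃ := key 0 1 1 2 (by decide) (by decide)
  have k₄ := key 0 2 0 1 (by decide) (by decide)
  have k₅ := key 0 2 0 2 (by decide) (by decide)
  have k₆ := key 0 2 1 2 (by decide) (by decide)
  have k₇ := key 1 2 0 1 (by decide) (by decide)
  have k₈ := key 1 2 0 2 (by decide) (by decide)
  have k₉ := key 1 2 1 2 (by decide) (by decide)
  clear key H ha hm
  rw [Int.odd_iff] at k₁ k₂ k₃ k₄ k₅ k₆ k₇ k₈ k₉
  omega

end SimpleGraph.IsPlanar

end MinorModels

section Cycles

variable {V : Type}

theorem connected_induce_singleton (G : SimpleGraph V) (v : V) :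
    (G.induce ({v} : Set V)).Connected :=
  { preconnected := SimpleGraph.Preconnected.of_subsingleton }

/-- A periodic enumeration of the vertices of a cycle of length `n` in `G`. -/
structure IsCyclicEnumeration (G : SimpleGraph V) (n : ℕ) (c : ℕ → V) : Prop where
  three_le : 3 ≤ n
  adj : ∀ k, G.Adj (c k) (c (k + 1))
  periodic : ∀ k, c (k + n) = c k
  ne : ∀ i j, i < j → j < i + n → c i ≠ c j

/-- A nonempty finite set all of whose vertices but one have two neighbours in it contains a
cycle. -/
theorem exists_isCyclicEnumeration [Finite V] {G : SimpleGraph V} {S : Set V} {v y : V}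
    (hv : v ∈ S) (hvy : v ≠ y)
    (h : ∀ v ∈ S, v ≠ y → ∀ u, ∃ z ∈ S, G.Adj v z ∧ z ≠ u) :
    ∃ n c, IsCyclicEnumeration G n c ∧ ∀ k, c k ∈ S := by
  let P (k : ℕ) (p : ℕ → V) : Prop := (∀ i ≤ k, p i ∈ S) ∧ (∀ i < k, G.Adj (p i) (p (i + 1))) ∧
    ∀ i ≤ k, ∀ j ≤ k, p i = p j → i = j
  have hbdd : BddAbove {k | ∃ p, P k p} := by
    refine ⟨Nat.card V, ?_⟩
    rintro k ⟨p, -, -, hp⟩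
    have := Nat.card_le_card_of_injective (fun i : Fin (k + 1) => p i) fun i j hij =>
      Fin.ext (hp i (by omega) j (by omega) hij)
    simp only [Nat.card_eq_fintype_card, Fintype.card_fin] at this
    omega
  have hP₀ : P 0 fun _ => v := ⟨fun _ _ => hv, by simp, fun i hi j hj _ => by omega⟩
  obtain ⟨p, hp⟩ : ∃ p, P (sSup {k | ∃ p, P k p}) p :=
    Nat.sSup_mem (s := {k | ∃ p, P k p}) ⟨0, _, hP₀⟩ hbdd
  have hmax : ∀ k p, P k p → k ≤ sSup {k | ∃ p, P k p} := fun k p hp => le_csSup hbdd ⟨p, hp⟩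
  generalize sSup {k | ∃ p, P k p} = m at hp hmax
  have hm : 0 < m := by
    obtain ⟨z, hz, hvz, -⟩ := h v hv hvy v
    refine hmax 1 (fun i => if i = 0 then v else z) ⟨?_, ?_, ?_⟩
    · intro i _
      by_cases hi : i = 0 <;> simp [hi, hv, hz]
    · intro i hi
      obtain rfl : i = 0 := by omega
      simpa using hvz
    · intro i hi j hj hij
      have := hvz.ne
      have := hvz.ne'
      by_cases hi : i = 0 <;> by_cases hj : j = 0 <;> simp_all
      omega
  obtain ⟨p, hp, hpy⟩ : ∃ p, P m p ∧ p 0 ≠ y := by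
    by_cases hpy : p 0 = y
    · refine ⟨fun i => p (m - i), ⟨fun i _ => hp.1 _ (by omega), fun i hi => ?_,
        fun i hi j hj hij => ?_⟩, fun hpm => ?_⟩
      · have := hp.2.1 (m - (i + 1)) (by omega)
        rw [show m - (i + 1) + 1 = m - i by omega] at this
        exact this.symm
      · have := hp.2.2 _ (by omega) _ (by omega) hij
        omega
      · have := hp.2.2 (m - 0) (by omega) 0 (by omega) (hpm.trans hpy.symm)
        omega
    · exact ⟨p, hp, hpy⟩
  obtain ⟨z, hzS, hz, hz1⟩ := h _ (hp.1 0 (by omega)) hpy (p 1)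
  obtain ⟨j, hj, rfl⟩ : ∃ j ≤ m, p j = z := by
    by_contra! hne
    refine absurd (hmax (m + 1) (fun i => if i = 0 then z else p (i - 1)) ⟨?_, ?_, ?_⟩) (by omega)
    · intro i hi
      by_cases h0 : i = 0
      · simpa [h0] using hzS
      · simpa [h0] using hp.1 _ (by omega)
    · intro i hi
      by_cases h0 : i = 0
      · simpa [h0] using hz.symm
      · have := hp.2.1 (i - 1) (by omega)
        rw [Nat.sub_add_cancel (by omega)] at this
        simpa [h0] using this
    · intro i hi j hj hij
      by_cases h0 : i = 0 <;> by_cases h1 : j = 0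
      · omega
      · simp only [h0, h1, if_true, if_false] at hij
        exact absurd hij.symm (hne _ (by omega))
      · simp only [h0, h1, if_true, if_false] at hij
        exact absurd hij (hne _ (by omega))
      · simp only [h0, h1, if_false] at hij
        have := hp.2.2 _ (by omega) _ (by omega) hij
        omega
  have hj0 : j ≠ 0 := by rintro rfl; exact hz.ne rfl
  have hj1 : j ≠ 1 := by rintro rfl; exact hz1 rfl
  have hlt : ∀ k, k % (j + 1) ≤ j := fun k => Nat.le_of_lt_succ (Nat.mod_lt _ (by omega))
  refine ⟨j + 1, fun k => p (k % (j + 1)), ⟨by omega, fun k => ?_, fun k => by simp, ?_⟩,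
    fun k => hp.1 _ ((hlt k).trans hj)⟩
  · have := hlt k
    rw [Nat.add_mod, Nat.mod_eq_of_lt (show 1 < j + 1 by omega)]
    rcases this.lt_or_eq with hk | hk
    · rw [Nat.mod_eq_of_lt (show k % (j + 1) + 1 < j + 1 by omega)]
      exact hp.2.1 _ (by omega)
    · rw [hk, Nat.mod_self]
      exact hz.symm
  · intro a b hab hba heq
    have := hp.2.2 _ ((hlt a).trans hj) _ ((hlt b).trans hj) heq
    have := (Nat.modEq_iff_dvd' hab.le).1 this
    exact absurd (Nat.le_of_dvd (by omega) this) (by omega)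

namespace IsCyclicEnumeration

variable {G : SimpleGraph V} {n : ℕ} {c : ℕ → V}

theorem connected_image_Ioo (hc : IsCyclicEnumeration G n c) {i j : ℕ} (hij : i + 1 < j) :
    (G.induce (c '' Set.Ioo i j)).Connected := by
  obtain ⟨d, rfl⟩ : ∃ d, j = i + 2 + d := ⟨j - (i + 2), by omega⟩
  clear hij
  induction d with
  | zero =>
    have : Set.Ioo i (i + 2 + 0) = {i + 1} := by
      ext k
      simp only [Set.mem_Ioo, Set.mem_singleton_iff]
      omega
    rw [this, Set.image_singleton]
    exact connected_induce_singleton G _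
  | succ d ih =>
    have : Set.Ioo i (i + 2 + (d + 1)) = Set.Ioo i (i + 2 + d) ∪ {i + 2 + d} := by
      ext k
      simp only [Set.mem_Ioo, Set.mem_union, Set.mem_singleton_iff]
      omega
    rw [this, Set.image_union, Set.image_singleton]
    refine SimpleGraph.connected_induce_union ih.preconnected
      (connected_induce_singleton G _).preconnected
      ⟨i + 1 + d, ⟨by omega, by omega⟩, rfl⟩ rfl ?_
    have := hc.adj (i + 1 + d)
    rwa [show i + 1 + d + 1 = i + 2 + d by omega] at this

theorem exists_eq (hc : IsCyclicEnumeration G n c) (i k : ℕ) :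
    ∃ k', i ≤ k' ∧ k' < i + n ∧ c k' = c k := by
  have hmul : ∀ q m, c (m + q * n) = c m := by
    intro q m
    induction q with
    | zero => simp
    | succ q ih => rw [Nat.succ_mul, ← add_assoc, hc.periodic, ih]
  have hn : 0 < n := by have := hc.three_le; omega
  have hin : i ≤ i * n := Nat.le_mul_of_pos_right i hn
  refine ⟨i + (k + i * n - i) % n, by omega, by have := Nat.mod_lt (k + i * n - i) hn; omega, ?_⟩
  rw [← hmul ((k + i * n - i) / n), ← hmul i k]
  congr 1
  have := Nat.mod_add_div' (k + i * n - i) n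
  omega

end IsCyclicEnumeration

end Cycles

section Separation

variable {V : Type} {G : SimpleGraph V}

/-- Some vertex of `S` is adjacent to some vertex of `T`. -/
def SetAdj (G : SimpleGraph V) (S T : Set V) : Prop := ∃ a ∈ S, ∃ b ∈ T, G.Adj a b

theorem SetAdj.symm {S T : Set V} (h : SetAdj G S T) : SetAdj G T S := by
  obtain ⟨a, ha, b, hb, hab⟩ := h
  exact ⟨b, hb, a, ha, hab.symm⟩

theorem SimpleGraph.IsPlanar.false_of_five (hG : G.IsPlanar) {S T U A R : Set V}
    (hd : [S, T, U, A, R].Pairwise Disjoint) (ha : [S, T, U, A, R].Pairwise (SetAdj G))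
    (hc : ∀ X ∈ [S, T, U, A, R], (G.induce X).Connected) : False := by
  refine hG.not_isMinorModel_completeGraph_five ([S, T, U, A, R].get) ⟨fun i => hc _ (by simp),
    fun i j hij => ?_, fun i j hij => ?_⟩
  · rcases hij.lt_or_gt with h | h
    · exact List.pairwise_iff_get.1 hd i j h
    · exact (List.pairwise_iff_get.1 hd j i h).symm
  · rcases hij.ne.lt_or_gt with h | h
    · exact List.pairwise_iff_get.1 ha i j h
    · exact (List.pairwise_iff_get.1 ha j i h).symm

theorem SimpleGraph.IsPlanar.false_of_three_three (hG : G.IsPlanar) {S T A P Q R : Set V}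
    (hd : [S, T, A, P, Q, R].Pairwise Disjoint)
    (ha : ∀ X ∈ [S, T, A], ∀ Y ∈ [P, Q, R], SetAdj G X Y)
    (hc : ∀ X ∈ [S, T, A, P, Q, R], (G.induce X).Connected) : False := by
  refine hG.not_isMinorModel_completeBipartiteGraph_three
    (Sum.elim [S, T, A].get [P, Q, R].get) ⟨?_, ?_, ?_⟩
  · rintro (i | i)
    · exact hc _ (List.mem_append_left [P, Q, R] (List.get_mem [S, T, A] i))
    · exact hc _ (List.mem_append_right [S, T, A] (List.get_mem [P, Q, R] i))
  · have hd' := List.pairwise_append.1 (show ([S, T, A] ++ [P, Q, R]).Pairwise Disjoint from hd)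
    rintro (i | i) (j | j) hij
    · rcases (show i ≠ j from fun h => hij (h ▸ rfl)).lt_or_gt with h | h
      · exact List.pairwise_iff_get.1 hd'.1 i j h
      · exact (List.pairwise_iff_get.1 hd'.1 j i h).symm
    · exact hd'.2.2 _ (List.get_mem [S, T, A] i) _ (List.get_mem [P, Q, R] j)
    · exact (hd'.2.2 _ (List.get_mem [S, T, A] j) _ (List.get_mem [P, Q, R] i)).symm
    · rcases (show i ≠ j from fun h => hij (h ▸ rfl)).lt_or_gt with h | h
      · exact List.pairwise_iff_get.1 hd'.2.1 i j h
      · exact (List.pairwise_iff_get.1 hd'.2.1 j i h).symm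
  · rintro (i | i) (j | j) hij
    · simp at hij
    · exact ha _ (List.get_mem [S, T, A] i) _ (List.get_mem [P, Q, R] j)
    · exact (ha _ (List.get_mem [S, T, A] j) _ (List.get_mem [P, Q, R] i)).symm
    · simp at hij

/-- The vertices of `W` which are adjacent to `A` form the outer boundary of `W`. Given a cycle of
boundary vertices avoiding the boundary vertex `x`, two adjacent (or equal) boundary vertices
`s`, `t` separate a part `R` containing `x` from the rest of `W`. -/
theorem SimpleGraph.IsPlanar.exists_separation (hG : G.IsPlanar) {A : Set V} {W : Finset V}
    (hA : (G.induce A).Connected) (hAW : ∀ a ∈ A, a ∉ W) {x : V} (hxW : x ∈ W)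
    (hxA : ∃ a ∈ A, G.Adj a x) {n : ℕ} {c : ℕ → V} (hc : IsCyclicEnumeration G n c)
    (hcW : ∀ k, c k ∈ W) (hcA : ∀ k, ∃ a ∈ A, G.Adj a (c k)) (hcx : ∀ k, c k ≠ x) :
    ∃ (s t : V) (R : Finset V), R ⊆ W ∧ x ∈ R ∧ s ∈ W ∧ t ∈ W ∧ s ∉ R ∧ t ∉ R ∧
      (∃ a ∈ A, G.Adj a s) ∧ (∃ a ∈ A, G.Adj a t) ∧ (s = t ∨ G.Adj s t) ∧
      (∃ z ∈ W, z ∉ R ∧ z ≠ s ∧ z ≠ t) ∧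
      ∀ a ∈ R, ∀ b ∈ W, b ∉ R → G.Adj a b → b = s ∨ b = t := by
  classical
  obtain ⟨R, hR, hRmax⟩ := Finset.exists_max_image
    (W.powerset.filter fun R : Finset V =>
      x ∈ R ∧ (∀ k, c k ∉ R) ∧ (G.induce (R : Set V)).Connected)
    Finset.card ⟨{x}, by
      simp only [Finset.mem_filter, Finset.mem_powerset, Finset.singleton_subset_iff,
        Finset.mem_singleton]
      refine ⟨hxW, trivial, hcx, ?_⟩
      rw [Finset.coe_singleton]
      exact connected_induce_singleton G x⟩
  simp only [Finset.mem_filter, Finset.mem_powerset] at hR hRmax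
  obtain ⟨hRW, hxR, hcR, hRconn⟩ := hR
  have hsep : ∀ a ∈ R, ∀ b ∈ W, b ∉ R → G.Adj a b → ∃ k, b = c k := by
    intro a ha b hb hbR hab
    by_contra! hbc
    refine absurd (hRmax (insert b R)
      ⟨Finset.insert_subset hb hRW, Finset.mem_insert_of_mem hxR, ?_, ?_⟩)
      (by rw [Finset.card_insert_of_notMem hbR]; omega)
    · intro k hk
      rcases Finset.mem_insert.1 hk with h | h
      · exact hbc k h.symm
      · exact hcR k h
    · rw [Finset.coe_insert, Set.insert_eq, Set.union_comm]
      exact SimpleGraph.connected_induce_union hRconn.preconnected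
        (connected_induce_singleton G b).preconnected ha rfl hab
  have hn := hc.three_le
  have hcA' : ∀ k, c k ∉ A := fun k h => hAW _ h (hcW k)
  have hAR : Disjoint A R := Set.disjoint_left.2 fun a ha haR => hAW a ha (hRW haR)
  have hAadjR : SetAdj G A R := by
    obtain ⟨a, ha, hax⟩ := hxA
    exact ⟨a, ha, x, hxR, hax⟩
  have hAadj : ∀ k, SetAdj G A {c k} := fun k => by
    obtain ⟨a, ha, hac⟩ := hcA k
    exact ⟨a, ha, c k, rfl, hac⟩
  let T (k : ℕ) : Prop := ∃ a ∈ R, G.Adj a (c k)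
  have hTadj : ∀ {k}, T k → SetAdj G {c k} R := by
    rintro k ⟨a, ha, hac⟩
    exact ⟨c k, rfl, a, ha, hac.symm⟩
  have hTper : ∀ {k l}, c k = c l → T k → T l := by
    rintro k l hkl ⟨a, ha, hac⟩
    exact ⟨a, ha, hkl ▸ hac⟩
  have hT : ∀ i j, T i → T j → i + 1 < j → j + 1 < i + n → False := by
    intro i j hi hj hij hji
    have hne : ∀ k l, i ≤ k → k < l → l < i + n → c k ≠ c l := fun k l h₁ h₂ h₃ =>
      hc.ne k l h₂ (by omega)
    refine hG.false_of_three_three (S := {c i}) (T := {c j}) (A := A) (P := c '' Set.Ioo i j)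
      (Q := c '' Set.Ioo j (i + n)) (R := R) ?_ ?_ ?_
    · simp only [List.pairwise_cons, List.mem_cons, List.not_mem_nil, or_false, forall_eq_or_imp,
        forall_eq, Set.disjoint_singleton_left, Set.mem_singleton_iff, IsEmpty.forall_iff,
        implies_true, List.Pairwise.nil, and_true]
      have hAc : ∀ I : Set ℕ, Disjoint A (c '' I) := fun I => Set.disjoint_left.2 <| by
        rintro _ ha ⟨k, -, rfl⟩
        exact hcA' k ha
      have hcR' : ∀ I : Set ℕ, Disjoint (c '' I) R := fun I => Set.disjoint_left.2 <| by
        rintro _ ⟨k, -, rfl⟩ hk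
        exact hcR k hk
      refine ⟨⟨hne _ _ (by omega) (by omega) (by omega), hcA' i, ?_, ?_, hcR i⟩,
        ⟨hcA' j, ?_, ?_, hcR j⟩, ⟨hAc _, hAc _, hAR⟩, ⟨?_, hcR' _⟩, hcR' _⟩
      · rintro ⟨k, ⟨hk₁, hk₂⟩, hk⟩
        exact hne i k (by omega) (by omega) (by omega) hk.symm
      · rintro ⟨k, ⟨hk₁, hk₂⟩, hk⟩
        exact hne i k (by omega) (by omega) (by omega) hk.symm
      · rintro ⟨k, ⟨hk₁, hk₂⟩, hk⟩
        exact hne k j (by omega) (by omega) (by omega) hk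
      · rintro ⟨k, ⟨hk₁, hk₂⟩, hk⟩
        exact hne j k (by omega) (by omega) (by omega) hk.symm
      · refine Set.disjoint_left.2 ?_
        rintro _ ⟨k, ⟨hk₁, hk₂⟩, rfl⟩ ⟨l, ⟨hl₁, hl₂⟩, hkl⟩
        exact hne k l (by omega) (by omega) (by omega) hkl.symm
    · have hpred : ∀ k, 0 < k → G.Adj (c k) (c (k - 1)) := fun k hk => by
        have := (hc.adj (k - 1)).symm
        rwa [Nat.sub_add_cancel (by omega)] at this
      have hAI : ∀ k (I : Set ℕ), k ∈ I → SetAdj G A (c '' I) := fun k I hk => by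
        obtain ⟨a, ha, hac⟩ := hcA k
        exact ⟨a, ha, c k, ⟨k, hk, rfl⟩, hac⟩
      simp only [List.mem_cons, List.not_mem_nil, or_false, forall_eq_or_imp, forall_eq]
      refine ⟨⟨?_, ?_, hTadj hi⟩, ⟨?_, ?_, hTadj hj⟩, hAI (i + 1) _ ⟨by omega, by omega⟩,
        hAI (j + 1) _ ⟨by omega, by omega⟩, hAadjR⟩
      · exact ⟨_, rfl, _, ⟨i + 1, ⟨by omega, by omega⟩, rfl⟩, hc.adj i⟩
      · refine ⟨_, rfl, _, ⟨i + n - 1, ⟨by omega, by omega⟩, rfl⟩, ?_⟩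
        rw [← hc.periodic i]
        exact hpred _ (by omega)
      · exact ⟨_, rfl, _, ⟨j - 1, ⟨by omega, by omega⟩, rfl⟩, hpred j (by omega)⟩
      · exact ⟨_, rfl, _, ⟨j + 1, ⟨by omega, by omega⟩, rfl⟩, hc.adj j⟩
    · simp only [List.mem_cons, List.not_mem_nil, or_false, forall_eq_or_imp, forall_eq]
      exact ⟨connected_induce_singleton G _, connected_induce_singleton G _, hA,
        hc.connected_image_Ioo hij, hc.connected_image_Ioo hji, hRconn⟩
  by_cases h2 : ∃ i, T i ∧ T (i + 1)
  · obtain ⟨i, hi, hi1⟩ := h2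
    by_cases h3 : ∃ k, i + 2 ≤ k ∧ k < i + n ∧ T k
    · exfalso
      obtain ⟨k, hk₁, hk₂, hk⟩ := h3
      have hkn : k + 1 = i + n := by
        by_contra hne
        exact hT i k hi hk (by omega) (by omega)
      have hk2 : k = i + 2 := by
        by_contra hne
        exact hT (i + 1) k hi1 hk (by omega) (by omega)
      obtain rfl : n = 3 := by omega
      subst hk2
      refine hG.false_of_five (S := {c i}) (T := {c (i + 1)}) (U := {c (i + 2)}) (A := A) (R := R)
        ?_ ?_ ?_
      · simp only [List.pairwise_cons, List.mem_cons, List.not_mem_nil, or_false, forall_eq_or_imp,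
          forall_eq, Set.disjoint_singleton_left, Set.mem_singleton_iff, IsEmpty.forall_iff,
          implies_true, List.Pairwise.nil, and_true]
        exact ⟨⟨hc.ne _ _ (by omega) (by omega), hc.ne _ _ (by omega) (by omega), hcA' _, hcR _⟩,
          ⟨hc.ne _ _ (by omega) (by omega), hcA' _, hcR _⟩, ⟨hcA' _, hcR _⟩, hAR⟩
      · simp only [List.pairwise_cons, List.mem_cons, List.not_mem_nil, or_false, forall_eq_or_imp,
          forall_eq, IsEmpty.forall_iff, implies_true, List.Pairwise.nil, and_true]
        have h2i := hc.adj (i + 2)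
        rw [show i + 2 + 1 = i + 3 from rfl, hc.periodic] at h2i
        exact ⟨⟨⟨_, rfl, _, rfl, hc.adj i⟩, ⟨_, rfl, _, rfl, h2i.symm⟩, (hAadj _).symm, hTadj hi⟩,
          ⟨⟨_, rfl, _, rfl, hc.adj (i + 1)⟩, (hAadj _).symm, hTadj hi1⟩,
          ⟨(hAadj _).symm, hTadj hk⟩, hAadjR⟩
      · simp only [List.mem_cons, List.not_mem_nil, or_false, forall_eq_or_imp, forall_eq]
        exact ⟨connected_induce_singleton G _, connected_induce_singleton G _,
          connected_induce_singleton G _, hA, hRconn⟩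
    · refine ⟨c i, c (i + 1), R, hRW, hxR, hcW _, hcW _, hcR _, hcR _, hcA _, hcA _,
        Or.inr (hc.adj i), ⟨c (i + 2), hcW _, hcR _, (hc.ne _ _ (by omega) (by omega)).symm,
        (hc.ne _ _ (by omega) (by omega)).symm⟩, fun a ha b hb hbR hab => ?_⟩
      obtain ⟨k, rfl⟩ := hsep a ha b hb hbR hab
      obtain ⟨l, hl₁, hl₂, hl⟩ := hc.exists_eq i k
      by_cases hl' : i + 2 ≤ l
      · exact absurd ⟨l, hl', hl₂, hTper hl.symm ⟨a, ha, hab⟩⟩ h3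
      · rcases (show l = i ∨ l = i + 1 by omega) with rfl | rfl
        · exact Or.inl hl.symm
        · exact Or.inr hl.symm
  · obtain ⟨i, hi⟩ : ∃ i, ∀ k, T k → c k = c i := by
      by_cases h1 : ∃ i, T i
      · obtain ⟨i, hi⟩ := h1
        refine ⟨i, fun k hk => ?_⟩
        obtain ⟨l, hl₁, hl₂, hl⟩ := hc.exists_eq i k
        have hTl : T l := hTper hl.symm hk
        rw [← hl]
        by_contra hli
        have hli' : l ≠ i := fun h => hli (h ▸ rfl)
        have hl1 : l ≠ i + 1 := by
          rintro rfl
          exact h2 ⟨i, hi, hTl⟩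
        have hln : l + 1 ≠ i + n := fun h =>
          h2 ⟨l, hTl, hTper (by rw [h, hc.periodic]) hi⟩
        exact hT i l hi hTl (by omega) (by omega)
      · exact ⟨0, fun k hk => absurd ⟨k, hk⟩ h1⟩
    refine ⟨c i, c i, R, hRW, hxR, hcW _, hcW _, hcR _, hcR _, hcA _, hcA _, Or.inl rfl,
      ⟨c (i + 1), hcW _, hcR _, (hc.adj i).ne', (hc.adj i).ne'⟩, fun a ha b hb hbR hab => ?_⟩
    obtain ⟨k, rfl⟩ := hsep a ha b hb hbR hab
    exact Or.inl (hi k ⟨a, ha, hab⟩)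

end Separation

section Colouring

variable {V : Type} {G : SimpleGraph V}

/-- Thomassen's inductive statement: `x` and `y`, equal or adjacent boundary vertices of `W`, are
precoloured by `ψ`, the other boundary vertices have lists of size at least three, and the remaining
vertices have lists of size at least five. -/
def ExtendsPrecolouring (G : SimpleGraph V) (A : Set V) (W : Finset V) : Prop :=
  ∀ x ∈ W, ∀ y ∈ W, (∃ a ∈ A, G.Adj a x) → (∃ a ∈ A, G.Adj a y) → (x = y ∨ G.Adj x y) →
    ∀ (L : V → Finset ℕ) (ψ : V → ℕ), (G.Adj x y → ψ x ≠ ψ y) →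
    (∀ w ∈ W, w ≠ x → w ≠ y → 3 ≤ (L w).card) →
    (∀ w ∈ W, (∀ a ∈ A, ¬ G.Adj a w) → 5 ≤ (L w).card) →
    ∃ φ : V → ℕ, φ x = ψ x ∧ φ y = ψ y ∧ (∀ w ∈ W, w ≠ x → w ≠ y → φ w ∈ L w) ∧
      ∀ u ∈ W, ∀ v ∈ W, G.Adj u v → φ u ≠ φ v

/-- Lists of size three on the boundary and five elsewhere suffice. -/
def BoundaryChoosable (G : SimpleGraph V) (A : Set V) (W : Finset V) : Prop :=
  ∀ L : V → Finset ℕ, (∀ w ∈ W, 3 ≤ (L w).card) →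
    (∀ w ∈ W, (∀ a ∈ A, ¬ G.Adj a w) → 5 ≤ (L w).card) →
    ∃ φ : V → ℕ, (∀ w ∈ W, φ w ∈ L w) ∧ ∀ u ∈ W, ∀ v ∈ W, G.Adj u v → φ u ≠ φ v

theorem update_ne_update_of_adj [DecidableEq V] {W : Finset V} {w : V} {c : ℕ} {φ : V → ℕ}
    (hφ : ∀ u ∈ W.erase w, ∀ v ∈ W.erase w, G.Adj u v → φ u ≠ φ v)
    (hw : ∀ v ∈ W, G.Adj w v → φ v ≠ c) :
    ∀ u ∈ W, ∀ v ∈ W, G.Adj u v → Function.update φ w c u ≠ Function.update φ w c v := by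
  intro u hu v hv huv
  by_cases huw : u = w
  · subst huw
    rw [Function.update_self, Function.update_of_ne huv.ne']
    exact (hw v hv huv).symm
  · rw [Function.update_of_ne huw]
    by_cases hvw : v = w
    · subst hvw
      rw [Function.update_self]
      exact hw u hu huv.symm
    · rw [Function.update_of_ne hvw]
      exact hφ u (Finset.mem_erase.2 ⟨huw, hu⟩) v (Finset.mem_erase.2 ⟨hvw, hv⟩) huv

theorem boundaryChoosable_of_extendsPrecolouring (k : ℕ)
    (H : ∀ (A : Set V) (W : Finset V), W.card ≤ k → (G.induce A).Connected → (∀ a ∈ A, a ∉ W) →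
      ExtendsPrecolouring G A W)
    (A : Set V) (W : Finset V) (hk : W.card ≤ k) (hA : A = ∅ ∨ (G.induce A).Connected)
    (hAW : ∀ a ∈ A, a ∉ W) : BoundaryChoosable G A W := by
  classical
  induction k generalizing A W with
  | zero =>
    obtain rfl : W = ∅ := Finset.card_eq_zero.1 (by omega)
    exact fun L _ _ => ⟨fun _ => 0, by simp, by simp⟩
  | succ k ih =>
    intro L h3 h5
    by_cases hO : ∃ x ∈ W, ∃ a ∈ A, G.Adj a x
    · obtain ⟨x, hx, a, ha, hax⟩ := hO
      have hA' : (G.induce A).Connected := hA.resolve_left (Set.nonempty_of_mem ha).ne_empty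
      obtain ⟨c, hc⟩ := Finset.card_pos.1 (show 0 < (L x).card by have := h3 x hx; omega)
      obtain ⟨φ, hφ, -, hφL, hφp⟩ := H A W hk hA' hAW x hx x hx ⟨a, ha, hax⟩ ⟨a, ha, hax⟩
        (Or.inl rfl) L (fun _ => c) (fun h => absurd rfl h.ne) (fun w hw _ _ => h3 w hw) h5
      refine ⟨φ, fun w hw => ?_, hφp⟩
      by_cases hwx : w = x
      · rw [hwx, hφ]
        exact hc
      · exact hφL w hw hwx hwx
    · push Not at hO
      rcases W.eq_empty_or_nonempty with rfl | ⟨w, hw⟩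
      · exact ⟨fun _ => 0, by simp, by simp⟩
      have hL : ∀ v ∈ W, 5 ≤ (L v).card := fun v hv => h5 v hv fun a ha => hO v hv a ha
      obtain ⟨c, hc⟩ := Finset.card_pos.1 (show 0 < (L w).card by have := h3 w hw; omega)
      have hcard := Finset.card_erase_of_mem hw
      obtain ⟨φ, hφL, hφp⟩ := ih (fun A W hWk => H A W (by omega)) {w} (W.erase w) (by omega)
        (Or.inr (connected_induce_singleton G w)) (by simp)
        (fun v => if G.Adj w v then (L v).erase c else L v)
        (fun v hv => by
          have := hL v (Finset.mem_of_mem_erase hv)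
          have := Finset.pred_card_le_card_erase (s := L v) (a := c)
          split_ifs <;> omega)
        (fun v hv hwv => by simpa [hwv w rfl] using hL v (Finset.mem_of_mem_erase hv))
      have hφw : ∀ v ∈ W, G.Adj w v → φ v ≠ c := fun v hv hwv => by
        have := hφL v (Finset.mem_erase.2 ⟨hwv.ne', hv⟩)
        rw [if_pos hwv] at this
        exact Finset.ne_of_mem_erase this
      refine ⟨Function.update φ w c, fun v hv => ?_, fun u hu v hv huv => ?_⟩
      · by_cases hvw : v = w
        · simpa [hvw] using hc
        · have := hφL v (Finset.mem_erase.2 ⟨hvw, hv⟩)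
          rw [Function.update_of_ne hvw]
          split_ifs at this
          exacts [Finset.mem_of_mem_erase this, this]
      · exact update_ne_update_of_adj hφp hφw u hu v hv huv

theorem SimpleGraph.IsPlanar.extendsPrecolouring [Finite V] (hG : G.IsPlanar) (A : Set V)
    (W : Finset V) (hA : (G.induce A).Connected) (hAW : ∀ a ∈ A, a ∉ W) :
    ExtendsPrecolouring G A W := by
  classical
  obtain ⟨k, hk⟩ : ∃ k, W.card ≤ k := ⟨_, le_rfl⟩
  induction k generalizing A W with
  | zero =>
    obtain rfl : W = ∅ := Finset.card_eq_zero.1 (by omega)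
    exact fun x hx => absurd hx (Finset.notMem_empty x)
  | succ k ih =>
    intro x hx y hy hxA hyA hxy L ψ hψ h3 h5
    by_cases h1 : ∀ v ∈ W, v ≠ x → v ≠ y → ∀ a ∈ A, ¬ G.Adj a v
    · obtain ⟨a, ha, hax⟩ := hxA
      obtain ⟨b, hb, hby⟩ := hyA
      have hA' : (G.induce (A ∪ {x} ∪ {y})).Connected := by
        refine SimpleGraph.connected_induce_union (SimpleGraph.connected_induce_union
          hA.preconnected (connected_induce_singleton G x).preconnected ha rfl hax).preconnected
          (connected_induce_singleton G y).preconnected (Or.inl hb) rfl hby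
      have hmem : ∀ {v}, v ∈ (W.erase x).erase y ↔ v ≠ y ∧ v ≠ x ∧ v ∈ W := by
        intro v
        rw [Finset.mem_erase, Finset.mem_erase]
      have hcard : ((W.erase x).erase y).card ≤ k := by
        have := Finset.card_erase_of_mem hx
        have := Finset.card_erase_le (s := W.erase x) (a := y)
        omega
      have h5' : ∀ v ∈ (W.erase x).erase y, 5 ≤ (L v).card := fun v hv => by
        obtain ⟨hvy, hvx, hv⟩ := hmem.1 hv
        exact h5 v hv (h1 v hv hvx hvy)
      obtain ⟨φ, hφL, hφp⟩ := boundaryChoosable_of_extendsPrecolouring k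
        (fun A W hW hA hAW => ih A W hA hAW hW) (A ∪ {x} ∪ {y}) ((W.erase x).erase y) hcard
        (Or.inr hA') (by
          rintro v ((hv | rfl) | rfl) hvW
          · exact hAW v hv (hmem.1 hvW).2.2
          · exact (hmem.1 hvW).2.1 rfl
          · exact (hmem.1 hvW).1 rfl)
        (fun v => if G.Adj x v ∨ G.Adj y v then L v \ {ψ x, ψ y} else L v)
        (fun v hv => by
          have := h5' v hv
          have := Finset.le_card_sdiff {ψ x, ψ y} (L v)
          have := Finset.card_le_two (a := ψ x) (b := ψ y)
          split_ifs <;> omega)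
        (fun v hv hvA => by
          rw [if_neg (not_or.2 ⟨hvA x (Or.inl (Or.inr rfl)), hvA y (Or.inr rfl)⟩)]
          exact h5' v hv)
      have hφxy : ∀ v ∈ (W.erase x).erase y, G.Adj x v ∨ G.Adj y v → φ v ≠ ψ x ∧ φ v ≠ ψ y :=
        fun v hv h => by
          have := hφL v hv
          rw [if_pos h] at this
          simpa using (Finset.mem_sdiff.1 this).2
      refine ⟨fun v => if v = x ∨ v = y then ψ v else φ v, by simp, by simp, fun w hw hwx hwy => ?_,
        fun u hu v hv huv => ?_⟩
      · have := hφL w (hmem.2 ⟨hwy, hwx, hw⟩)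
        simp only [hwx, hwy, or_self, if_false]
        split_ifs at this
        exacts [(Finset.mem_sdiff.1 this).1, this]
      · have hout : ∀ u v, (u = x ∨ u = y) → v ∈ W → ¬ (v = x ∨ v = y) → G.Adj u v → ψ u ≠ φ v := by
          rintro u v (rfl | rfl) hv hvxy huv
          · exact (hφxy v (hmem.2 ⟨fun h => hvxy (Or.inr h), fun h => hvxy (Or.inl h), hv⟩)
              (Or.inl huv)).1.symm
          · exact (hφxy v (hmem.2 ⟨fun h => hvxy (Or.inr h), fun h => hvxy (Or.inl h), hv⟩)
              (Or.inr huv)).2.symm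
        dsimp only
        split_ifs with hu' hv' hv'
        · rcases hu' with rfl | rfl <;> rcases hv' with rfl | rfl
          exacts [absurd rfl huv.ne, hψ huv, (hψ huv.symm).symm, absurd rfl huv.ne]
        · exact hout u v hu' hv hv' huv
        · exact (hout v u hv' hu hu' huv.symm).symm
        · rw [not_or] at hu' hv'
          exact hφp u (hmem.2 ⟨hu'.2, hu'.1, hu⟩) v (hmem.2 ⟨hv'.2, hv'.1, hv⟩) huv
    push Not at h1
    obtain ⟨v₀, hv₀, hv₀x, hv₀y, hv₀A⟩ := h1
    by_cases h2 : ∃ v ∈ W, v ≠ x ∧ v ≠ y ∧ (∃ a ∈ A, G.Adj a v) ∧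
        ∃ u, ∀ z ∈ W, G.Adj v z → (∃ a ∈ A, G.Adj a z) → z = x ∨ z = u
    · obtain ⟨v, hv, hvx, hvy, ⟨d, hd, hdv⟩, u, hu⟩ := h2
      obtain ⟨a, ha, b, hb, hab⟩ := Finset.one_lt_card.1
        (show 1 < ((L v).erase (ψ x)).card by
          have := h3 v hv hvx hvy
          have := Finset.pred_card_le_card_erase (s := L v) (a := ψ x)
          omega)
      rw [Finset.mem_erase] at ha hb
      have hA' : (G.induce (A ∪ {v})).Connected := SimpleGraph.connected_induce_union
        hA.preconnected (connected_induce_singleton G v).preconnected hd rfl hdv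
      have hcard := Finset.card_erase_of_mem hv
      obtain ⟨φ, hφx, hφy, hφL, hφp⟩ := ih (A ∪ {v}) (W.erase v) hA'
        (by
          rintro z (hz | rfl) hzW
          · exact hAW z hz (Finset.mem_of_mem_erase hzW)
          · exact Finset.notMem_erase _ _ hzW)
        (by omega) x (Finset.mem_erase.2 ⟨hvx.symm, hx⟩) y (Finset.mem_erase.2 ⟨hvy.symm, hy⟩)
        (hxA.imp fun a h => ⟨Or.inl h.1, h.2⟩) (hyA.imp fun a h => ⟨Or.inl h.1, h.2⟩) hxy
        (fun z => if G.Adj v z ∧ ∀ a ∈ A, ¬ G.Adj a z then L z \ {a, b} else L z) ψ hψ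
        (fun z hz hzx hzy => by
          have hz' := Finset.mem_of_mem_erase hz
          split_ifs with h
          · have := h5 z hz' h.2
            have := Finset.le_card_sdiff {a, b} (L z)
            have := Finset.card_le_two (a := a) (b := b)
            omega
          · exact h3 z hz' hzx hzy)
        (fun z hz hzA => by
          rw [if_neg fun h => hzA v (Or.inr rfl) h.1]
          exact h5 z (Finset.mem_of_mem_erase hz) fun a ha => hzA a (Or.inl ha))
      obtain ⟨e, he, heu⟩ : ∃ e, (e = a ∨ e = b) ∧ e ≠ φ u := by
        by_cases h : a = φ u
        · exact ⟨b, Or.inr rfl, fun h' => hab (h.trans h'.symm)⟩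
        · exact ⟨a, Or.inl rfl, h⟩
      have heL : e ≠ ψ x ∧ e ∈ L v := by
        rcases he with rfl | rfl
        exacts [ha, hb]
      have hev : ∀ z ∈ W, G.Adj v z → φ z ≠ e := by
        intro z hz hvz
        by_cases hzA : ∃ a ∈ A, G.Adj a z
        · rcases hu z hz hvz hzA with rfl | rfl
          · rw [hφx]
            exact heL.1.symm
          · exact heu.symm
        · have hzx : z ≠ x := fun h => hzA (h ▸ hxA)
          have hzy : z ≠ y := fun h => hzA (h ▸ hyA)
          push Not at hzA
          have := hφL z (Finset.mem_erase.2 ⟨hvz.ne', hz⟩) hzx hzy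
          rw [if_pos ⟨hvz, hzA⟩, Finset.mem_sdiff, Finset.mem_insert, Finset.mem_singleton] at this
          exact fun h => this.2 (h ▸ he)
      refine ⟨Function.update φ v e, ?_, ?_, fun w hw hwx hwy => ?_, fun p hp q hq hpq => ?_⟩
      · rwa [Function.update_of_ne hvx.symm]
      · rwa [Function.update_of_ne hvy.symm]
      · by_cases hwv : w = v
        · simpa [hwv] using heL.2
        · have := hφL w (Finset.mem_erase.2 ⟨hwv, hw⟩) hwx hwy
          rw [Function.update_of_ne hwv]
          split_ifs at this
          exacts [(Finset.mem_sdiff.1 this).1, this]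
      · exact update_ne_update_of_adj hφp hev p hp q hq hpq
    push Not at h2
    obtain ⟨n, c, hc, hcS⟩ := exists_isCyclicEnumeration (G := G)
      (S := {z | z ∈ W ∧ (∃ a ∈ A, G.Adj a z) ∧ z ≠ x}) (y := y) ⟨hv₀, hv₀A, hv₀x⟩ hv₀y
      (fun v hv hvy u => by
        obtain ⟨z, hz, hvz, hzA, hzx, hzu⟩ := h2 v hv.1 hv.2.2 hvy hv.2.1 u
        exact ⟨z, ⟨hz, hzA, hzx⟩, hvz, hzu⟩)
    obtain ⟨s, t, R, hRW, hxR, hs, ht, hsR, htR, hsA, htA, hst, ⟨z, hz, hzR, hzs, hzt⟩, hsep⟩ :=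
      hG.exists_separation hA hAW hx hxA hc (fun i => (hcS i).1) (fun i => (hcS i).2.1)
        fun i => (hcS i).2.2
    have hW₁ : insert s (insert t R) ⊆ W := Finset.insert_subset hs (Finset.insert_subset ht hRW)
    have hR₁ : ∀ {w}, w ∈ R → w ∈ insert s (insert t R) := fun h =>
      Finset.mem_insert_of_mem (Finset.mem_insert_of_mem h)
    have hy₁ : y ∈ insert s (insert t R) := by
      by_cases hyR : y ∈ R
      · exact hR₁ hyR
      · have hxy' : G.Adj x y := hxy.resolve_left fun h => hyR (h ▸ hxR)
        rcases hsep x hxR y hy hyR hxy' with rfl | rfl <;> simp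
    have hcard₁ : (insert s (insert t R)).card < W.card := Finset.card_lt_card <|
      hW₁.ssubset_of_mem_notMem hz (by simp [hzR, hzs, hzt])
    have hcard₂ : (W \ R).card < W.card := Finset.card_lt_card <|
      Finset.sdiff_subset.ssubset_of_mem_notMem hx fun h => (Finset.mem_sdiff.1 h).2 hxR
    obtain ⟨φ₁, hφ₁x, hφ₁y, hφ₁L, hφ₁p⟩ := ih A (insert s (insert t R)) hA
      (fun a ha h => hAW a ha (hW₁ h)) (by omega) x (hR₁ hxR) y hy₁ hxA hyA hxy L ψ hψ
      (fun w hw => h3 w (hW₁ hw)) (fun w hw => h5 w (hW₁ hw))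
    have hs₁ : s ∈ insert s (insert t R) := Finset.mem_insert_self _ _
    have ht₁ : t ∈ insert s (insert t R) := Finset.mem_insert_of_mem (Finset.mem_insert_self _ _)
    have hne : ∀ {w}, w ∉ R → w ≠ s → w ≠ t → w ≠ x ∧ w ≠ y := fun hwR hws hwt =>
      ⟨fun h => hwR (h ▸ hxR), by
        rintro rfl
        simp [hwR, hws, hwt] at hy₁⟩
    obtain ⟨φ₂, hφ₂s, hφ₂t, hφ₂L, hφ₂p⟩ := ih A (W \ R) hA
      (fun a ha h => hAW a ha (Finset.mem_sdiff.1 h).1) (by omega)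
      s (Finset.mem_sdiff.2 ⟨hs, hsR⟩) t (Finset.mem_sdiff.2 ⟨ht, htR⟩) hsA htA hst L φ₁
      (hφ₁p s hs₁ t ht₁)
      (fun w hw hws hwt =>
        have hw' := Finset.mem_sdiff.1 hw
        h3 w hw'.1 (hne hw'.2 hws hwt).1 (hne hw'.2 hws hwt).2)
      (fun w hw => h5 w (Finset.mem_sdiff.1 hw).1)
    have hφ₁ : ∀ w ∈ insert s (insert t R), (if w ∈ R then φ₁ w else φ₂ w) = φ₁ w := by
      intro w hw
      split_ifs with hwR
      · rfl
      · rcases (show w = s ∨ w = t by simpa [hwR] using hw) with rfl | rfl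
        exacts [hφ₂s, hφ₂t]
    have hsep' : ∀ p ∈ R, ∀ q ∈ W, q ∉ R → G.Adj p q → φ₁ p ≠ φ₂ q := by
      intro p hp q hq hqR hpq
      have hq₁ : q ∈ insert s (insert t R) := by
        rcases hsep p hp q hq hqR hpq with rfl | rfl
        exacts [hs₁, ht₁]
      have := hφ₁ q hq₁
      rw [if_neg hqR] at this
      rw [this]
      exact hφ₁p p (hR₁ hp) q hq₁ hpq
    refine ⟨fun w => if w ∈ R then φ₁ w else φ₂ w, (hφ₁ x (hR₁ hxR)).trans hφ₁x,
      (hφ₁ y hy₁).trans hφ₁y, fun w hw hwx hwy => ?_, fun p hp q hq hpq => ?_⟩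
    · by_cases hw₁ : w ∈ insert s (insert t R)
      · dsimp only
        rw [hφ₁ w hw₁]
        exact hφ₁L w hw₁ hwx hwy
      · simp only [Finset.mem_insert, not_or] at hw₁
        dsimp only
        rw [if_neg hw₁.2.2]
        exact hφ₂L w (Finset.mem_sdiff.2 ⟨hw, hw₁.2.2⟩) hw₁.1 hw₁.2.1
    · dsimp only
      split_ifs with hpR hqR hqR
      · exact hφ₁p p (hR₁ hpR) q (hR₁ hqR) hpq
      · exact hsep' p hpR q hq hqR hpq
      · exact (hsep' q hqR p hp hpR hpq.symm).symm
      · exact hφ₂p p (Finset.mem_sdiff.2 ⟨hp, hpR⟩) q (Finset.mem_sdiff.2 ⟨hq, hqR⟩) hpq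

end Colouring

/-- Thomassen's theorem: every planar graph is 5-choosable. -/
theorem planar_5_choosable {V : Type} [Fintype V]
    (G : SimpleGraph V) (hplanar : G.IsPlanar)
    (L : V → Finset ℕ) (hL : ∀ v, 5 ≤ (L v).card) :
    ∃ φ : V → ℕ, ProperListColoring G L φ := by
  obtain ⟨φ, hφL, hφp⟩ := boundaryChoosable_of_extendsPrecolouring (G := G) _
    (fun A W _ hA hAW => hplanar.extendsPrecolouring A W hA hAW) ∅ Finset.univ le_rfl
    (Or.inl rfl) (by simp) L (fun v _ => (by omega : 3 ≤ 5).trans (hL v)) (fun v _ _ => hL v)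
  exact ⟨φ, fun v => hφL v (Finset.mem_univ v),
    fun u v => hφp u (Finset.mem_univ u) v (Finset.mem_univ v)⟩
end
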